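/- For all k, k₁, k₂, k₃ ∈ ℤ and f₁, f₂, f₃ for which the right-hand sides are finite, the localized trilinear Muskat pseudoproduct satisfies ‖P_k[ 𝒯₃(P_{k₁}f₁, P_{k₂}f₂, P_{k₃}f₃) ]‖_{L²} ≲ 2^k ‖P_{k₁}f₁‖_{L²} ‖P_{k₂}f₂‖_{L^∞} ‖P_{k₃}f₃‖_{L^∞}, and alternatively ‖P_k[ 𝒯₃(P_{k₁}f₁, P_{k₂}f₂, P_{k₃}f₃) ]‖_{L²} ≲ 2^k 2^{k/2} ‖P_{k₁}f₁‖_{L²} ‖P_{k₂}f₂‖_{L²} ‖P_{k₃}f₃‖_{L^∞}. -/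

import Mathlib

open MeasureTheory Real Complex Filter Set
open scoped FourierTransform ENNReal NNReal Topology

noncomputable section

namespace Muskat

/-- Dyadic dilate of the Littlewood–Paley bump: `φ_k(ξ) = φ₀(2^{-k} ξ)`. -/
def phi (φ₀ : ℝ → ℝ) (k : ℤ) (ξ : ℝ) : ℝ := φ₀ ((2:ℝ) ^ (-k) * ξ)

/-- `φ_{≤l} = ∑_{k' ≤ l} φ_{k'}`. -/
def phiLE (φ₀ : ℝ → ℝ) (l : ℤ) (ξ : ℝ) : ℝ :=
  ∑' k : ℤ, if k ≤ l then phi φ₀ k ξ else 0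

/-- The Littlewood–Paley projection `P_k f = 𝓕⁻¹(φ_k ⬝ 𝓕 f)`. -/
def P (φ₀ : ℝ → ℝ) (k : ℤ) (f : ℝ → ℂ) : ℝ → ℂ :=
  fun x => 𝓕⁻ (fun ξ => (phi φ₀ k ξ : ℂ) * 𝓕 f ξ) x

/-- The low-frequency projection `P_{≤l} f = 𝓕⁻¹(φ_{≤l} ⬝ 𝓕 f)`. -/
def PLE (φ₀ : ℝ → ℝ) (l : ℤ) (f : ℝ → ℂ) : ℝ → ℂ :=
  fun x => 𝓕⁻ (fun ξ => (phiLE φ₀ l ξ : ℂ) * 𝓕 f ξ) x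

/-- The Fourier multiplier `|∇|` with symbol `|ξ|`. -/
def absD (f : ℝ → ℂ) : ℝ → ℂ :=
  fun x => 𝓕⁻ (fun ξ => ((|ξ| : ℝ) : ℂ) * 𝓕 f ξ) x

/-- `φ₀` is an even smooth bump supported in `{1/2 ≤ |ξ| ≤ 2}` generating a dyadic
partition of unity. -/
def IsLPBump (φ₀ : ℝ → ℝ) : Prop :=
  ContDiff ℝ (⊤ : ℕ∞) φ₀ ∧ (∀ ξ, φ₀ ξ ∈ Set.Icc (0:ℝ) 1) ∧ (∀ ξ, φ₀ (-ξ) = φ₀ ξ) ∧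
    (∀ ξ, φ₀ ξ ≠ 0 → |ξ| ∈ Set.Icc (1/2 : ℝ) 2) ∧
    (∀ ξ : ℝ, ξ ≠ 0 → HasSum (fun k : ℤ => phi φ₀ k ξ) 1)

/-- `x ↦ x ∂ₓ f(x)`. -/
def xDeriv (f : ℝ → ℂ) : ℝ → ℂ := fun x => (x : ℂ) * deriv f x

/-- The `Z₁` norm. -/
def Z1Norm (φ₀ : ℝ → ℝ) (F : ℝ → ℝ → ℂ) : ℝ≥0∞ :=
  ⨆ (t : ℝ) (_ : 0 ≤ t),
    (eLpNorm (F t) ⊤ volume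
      + (⨆ k : ℤ, ENNReal.ofReal (((2:ℝ) ^ k * t) ^ (1/10 : ℝ)) *
          eLpNorm (P φ₀ k (F t)) ⊤ volume)
      + eLpNorm (xDeriv (F t)) ⊤ volume
      + ⨆ k : ℤ, ENNReal.ofReal (((2:ℝ) ^ k * t) ^ (1/10 : ℝ)) *
          eLpNorm (P φ₀ k (xDeriv (F t))) ⊤ volume)

/-- The `Z₂` norm. -/
def Z2Norm (φ₀ : ℝ → ℝ) (F : ℝ → ℝ → ℂ) : ℝ≥0∞ :=
  ⨆ (t : ℝ) (_ : 0 ≤ t) (k : ℤ),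
    ENNReal.ofReal ((2:ℝ) ^ ((k:ℝ)/2) *
        (max ((2:ℝ)^k * t) (1/((2:ℝ)^k * t))) ^ (1/10 : ℝ)) *
      eLpNorm (P φ₀ k (F t)) 2 volume

/-- The sum-space norm of `Z = Z₁ + Z₂`. -/
def ZNorm (φ₀ : ℝ → ℝ) (F : ℝ → ℝ → ℂ) : ℝ≥0∞ :=
  ⨅ (G : ℝ → ℝ → ℂ) (H : ℝ → ℝ → ℂ) (_ : F = G + H), Z1Norm φ₀ G + Z2Norm φ₀ H

/-- The `N` norm measuring the nonlinearity. -/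
def NNorm (φ₀ : ℝ → ℝ) (F : ℝ → ℝ → ℂ) : ℝ≥0∞ :=
  ⨆ (t : ℝ) (_ : 0 ≤ t) (k : ℤ),
    ENNReal.ofReal ((2:ℝ) ^ ((k:ℝ)/2) * ((2:ℝ)^k * t) ^ (-(1/10) : ℝ)) *
      eLpNorm (P φ₀ k (F t)) 2 volume

/-- Time-uniform `L^∞` norm. -/
def LinfNorm (F : ℝ → ℝ → ℂ) : ℝ≥0∞ :=
  ⨆ (t : ℝ) (_ : 0 ≤ t), eLpNorm (F t) ⊤ volume

/-- `Φ_{≤ l}`: a smooth cutoff adapted to the base points `a`, at scale `2^l`. -/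
def IsCutoff {M : ℕ} (a : Fin M → ℝ) (l : ℤ) (Φ : ℝ → ℝ) : Prop :=
  ContDiff ℝ (⊤ : ℕ∞) Φ ∧ (∀ x, Φ x ∈ Set.Icc (0:ℝ) 1) ∧
    (∀ x, (∃ j, |x - a j| < (2:ℝ) ^ (l-2)) → Φ x = 1) ∧
    (∀ x, Φ x ≠ 0 → ∃ j, |x - a j| < (2:ℝ) ^ (l+2)) ∧
    ∃ C : ℝ, 0 < C ∧ ∀ n ∈ Finset.Icc 1 3, ∀ x : ℝ,
      |iteratedDeriv n Φ x| ≤ C * (2:ℝ) ^ (-(n:ℤ) * l)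

/-- The bounds \eqref{q_bounds} satisfied by the change of variables `q`. -/
def QBounds {M : ℕ} (a : Fin M → ℝ) (ε : ℝ) (q : ℝ → ℝ → ℝ) : Prop :=
  ∃ (Φ : ℝ → ℝ) (C : ℝ), IsCutoff a 0 Φ ∧ 0 < C ∧
    (∀ t x, 0 < t → t ≤ 1 → |q t x| ≤ C * ε * t * Real.log (2/t) * Φ x) ∧
    (∀ t x, 0 ≤ t → |deriv (q t) x| ≤ C * ε) ∧
    (∀ t x, 1 ≤ t → deriv (fun s => q s x) t = 0)

/-- The bounds \eqref{qtilde_bounds}: `Q(t,x) = x + q(t,x)` is a strictly increasing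
bijection with inverse `Q̃(t,y) = y + q̃(t,y)`, and `q̃` satisfies singular derivative
bounds at the base points. -/
def QtildeBounds {M : ℕ} (a : Fin M → ℝ) (ε : ℝ) (q qt : ℝ → ℝ → ℝ) : Prop :=
  (∀ t, 0 ≤ t → StrictMono (fun x => x + q t x)) ∧
  (∀ t x, 0 ≤ t → (x + qt t x) + q t (x + qt t x) = x) ∧
  (∀ t y, 0 ≤ t → (y + q t y) + qt t (y + q t y) = y) ∧
  ∃ C : ℝ, 0 < C ∧ ∀ n ∈ Finset.Icc 1 3, ∀ t y : ℝ, 0 ≤ t →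
    |iteratedDeriv n (qt t) y| ≤ C * ε * ∑ j, |y - a j| ^ ((1:ℤ) - (n:ℤ))

/-- `φ̃_k = ∑_{|a| ≤ 2} φ_{k+a}`. -/
def phiT (φ₀ : ℝ → ℝ) (k : ℤ) (ξ : ℝ) : ℝ :=
  ∑ a ∈ Finset.Icc (-2:ℤ) 2, phi φ₀ (k + a) ξ

/-- `ψ₀ = 𝓕⁻¹(φ̃₀(ξ)/(iξ))`. -/
def psi0 (φ₀ : ℝ → ℝ) : ℝ → ℂ :=
  𝓕⁻ (fun ξ : ℝ => (phiT φ₀ 0 ξ : ℂ) / (Complex.I * (ξ:ℂ)))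

/-- `ψ_{≤0} = 𝓕⁻¹(φ̃_{≤0}(ξ)/(iξ))`. -/
def psiLE0 (φ₀ : ℝ → ℝ) : ℝ → ℂ :=
  𝓕⁻ (fun ξ : ℝ => (phiLE φ₀ 2 ξ : ℂ) / (Complex.I * (ξ:ℂ)))

/-- The kernel `L_k(x,α) = (ψ₀(2^k x) - ψ₀(2^k (x-α)))/α`. -/
def Lker (φ₀ : ℝ → ℝ) (k : ℤ) (x α : ℝ) : ℂ :=
  (psi0 φ₀ ((2:ℝ)^k * x) - psi0 φ₀ ((2:ℝ)^k * (x - α))) / (α:ℂ)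

/-- The kernel `L_{≤k}(x,α) = (ψ_{≤0}(2^k x) - ψ_{≤0}(2^k (x-α)))/α`. -/
def LkerLE (φ₀ : ℝ → ℝ) (k : ℤ) (x α : ℝ) : ℂ :=
  (psiLE0 φ₀ ((2:ℝ)^k * x) - psiLE0 φ₀ ((2:ℝ)^k * (x - α))) / (α:ℂ)

/-- Modified kernel `L̃_k`. -/
def LkerTil (φ₀ : ℝ → ℝ) (k : ℤ) (x α : ℝ) : ℂ :=
  Lker φ₀ k x α - ((α:ℂ))⁻¹ * ((min 1 ((2:ℝ)^k * α) : ℝ) : ℂ) *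
    deriv (psi0 φ₀) ((2:ℝ)^k * x)

/-- Modified kernel `L̃_{≤k}`. -/
def LkerLETil (φ₀ : ℝ → ℝ) (k : ℤ) (x α : ℝ) : ℂ :=
  LkerLE φ₀ k x α - ((α:ℂ))⁻¹ * ((min 1 ((2:ℝ)^k * α) : ℝ) : ℂ) *
    deriv (psiLE0 φ₀) ((2:ℝ)^k * x)

/-- `f*(x,α) = (1/α) ∫_{x-α}^x f(y) dy`. -/
def fstar (f : ℝ → ℂ) (x α : ℝ) : ℂ := ((α:ℂ))⁻¹ * ∫ y in (x - α)..x, f y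

/-- The trilinear Muskat operator `𝒯₃`. -/
def T3 (f₁ f₂ f₃ : ℝ → ℂ) : ℝ → ℂ :=
  fun x => -(1/Real.pi : ℂ) *
    deriv (fun z => ∫ α : ℝ,
      deriv (fun w => fstar f₁ w α) z * fstar f₂ z α * fstar f₃ z α) x

/-- `h*(t,x,α) = (1/α) ∫_{x-α}^x h(t,y) dy` for real-valued `h`. -/
def hstar (h : ℝ → ℝ → ℝ) (t x α : ℝ) : ℝ := (1/α) * ∫ y in (x - α)..x, h t y

/-- `h` solves the Muskat equation
`∂ₜ h = (1/π) d/dx ∫ ∂ₓ h*(t,x,α)/(1 + h*(t,x,α)²) dα` for positive times. -/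
def SolvesMuskat (h : ℝ → ℝ → ℝ) : Prop :=
  ∀ t x : ℝ, 0 < t →
    HasDerivAt (fun s => h s x)
      ((1/Real.pi) * deriv (fun z => ∫ α : ℝ,
        deriv (fun w => hstar h t w α) z / (1 + (hstar h t z α)^2)) x) t

/-- `g⁺(t,x,α)` from the decomposition of `Z₁` functions. -/
def gplus (q : ℝ → ℝ → ℝ) (g : ℝ → ℝ → ℂ) (t x α : ℝ) : ℂ :=
  ((α:ℂ))⁻¹ * ∫ y in (0:ℝ)..α, g t (-y + q t (x - y) - q t x)

/-- `g⁻(t,x,α)` from the decomposition of `Z₁` functions. -/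
def gminus (q : ℝ → ℝ → ℝ) (g : ℝ → ℝ → ℂ) (t x α : ℝ) : ℂ :=
  -((α:ℂ))⁻¹ * ∫ y in α..(0:ℝ), g t (-y + q t (x - y) - q t x)

/-- The core part `p(t,x,α)` of a `Z₁` function with base point `a`. -/
def pfun (q : ℝ → ℝ → ℝ) (g : ℝ → ℝ → ℂ) (a t x α : ℝ) : ℂ :=
  if |α| < |x - a + q t x| / 4 then g t (x - a + q t x)
  else if 4 * |x - a + q t x| < |α| then
    (if 0 < α then gplus q g t x α else gminus q g t x α)
  else 0

/-- The operator `T(g)(t,x,α,k)`. -/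
def Top (φ₀ : ℝ → ℝ) (q : ℝ → ℝ → ℝ) (g : ℝ → ℝ → ℂ) (a : ℝ) (k : ℤ)
    (t x α : ℝ) : ℂ :=
  ∫ y : ℝ, g t (x - a - y + q t (x - y)) *
    (psiLE0 φ₀ ((2:ℝ)^k * y) - psiLE0 φ₀ ((2:ℝ)^k * (y - α))) / (α:ℂ)

/-- The velocity field `V[g₁,g₂]`. -/
def Vfield (q : ℝ → ℝ → ℝ) (g₁ g₂ : ℝ → ℝ → ℂ) (a₁ a₂ t x : ℝ) : ℂ :=
  -(1/Real.pi : ℂ) * ∫ α in {α : ℝ | t ≤ |α|},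
    pfun q g₁ a₁ t x α * pfun q g₂ a₂ t x α / (α:ℂ)

/-- `g*(t,0,α) = (1/α)∫_0^α g(t,-ρ) dρ`. -/
def gstar0 (g : ℝ → ℝ → ℂ) (t α : ℝ) : ℂ := ((α:ℂ))⁻¹ * ∫ ρ in (0:ℝ)..α, g t (-ρ)

/-- The function `r(t,y,α)` entering the definition of `V₁`. -/
def rfun (φ₀ : ℝ → ℝ) (g : ℝ → ℝ → ℂ) (a t y α : ℝ) : ℂ :=
  gstar0 g t α * ((phiLE φ₀ (-4) ((y - a)/α) : ℝ) : ℂ)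
    + g t (y - a) * ((phiLE φ₀ (-4) (α/(y - a)) : ℝ) : ℂ)

/-- The main part `V₁[g₁,g₂]` of the renormalized velocity field. -/
def V1field (φ₀ : ℝ → ℝ) (g₁ g₂ : ℝ → ℝ → ℂ) (a₁ a₂ t y : ℝ) : ℂ :=
  -(1/Real.pi : ℂ) * ∫ α in {α : ℝ | |α| ∈ Set.Icc t ((2:ℝ)^(-20:ℤ))},
    rfun φ₀ g₁ a₁ t y α * rfun φ₀ g₂ a₂ t y α / (α:ℂ)

/-- Largest entry of a triple of integers. -/
def k1star (k₁ k₂ k₃ : ℤ) : ℤ := max k₁ (max k₂ k₃)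

/-- Smallest entry of a triple of integers. -/
def k3star (k₁ k₂ k₃ : ℤ) : ℤ := min k₁ (min k₂ k₃)

/-- Middle entry of a triple of integers. -/
def k2star (k₁ k₂ k₃ : ℤ) : ℤ := k₁ + k₂ + k₃ - k1star k₁ k₂ k₃ - k3star k₁ k₂ k₃

/-- The frequency region `S_{k,2}` (high-high interactions). -/
def Sk2 (k : ℤ) : Set (ℤ × ℤ × ℤ) :=
  {p | |k1star p.1 p.2.1 p.2.2 - k2star p.1 p.2.1 p.2.2| ≤ 10 ∧
       k - 3 ≤ k1star p.1 p.2.1 p.2.2 ∧ k - 5 ≤ k2star p.1 p.2.1 p.2.2}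

/-- The frequency region `S_{k,1}` (low-high interactions). -/
def Sk1 (k : ℤ) : Set (ℤ × ℤ × ℤ) :=
  {p | k - 3 ≤ k1star p.1 p.2.1 p.2.2 ∧ k1star p.1 p.2.1 p.2.2 ≤ k + 3 ∧
       k2star p.1 p.2.1 p.2.2 ≤ k - 6 ∧ k3star p.1 p.2.1 p.2.2 ≤ k - 6}

/-- The components of a triple. -/
def comp3 (p : ℤ × ℤ × ℤ) : Fin 3 → ℤ := ![p.1, p.2.1, p.2.2]

/-- `S_{k,1}^a`: triples of `S_{k,1}` whose maximum is attained at index `a`. -/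
def Sk1i (k : ℤ) (i : Fin 3) : Set (ℤ × ℤ × ℤ) :=
  {p | p ∈ Sk1 k ∧ comp3 p i = k1star p.1 p.2.1 p.2.2}

/-- The localized trilinear expression `∑_{(k₁,k₂,k₃) ∈ S} P_k 𝒯₃(P_{k₁}h₁,P_{k₂}h₂,P_{k₃}h₃)`. -/
def Gsum (φ₀ : ℝ → ℝ) (S : Set (ℤ × ℤ × ℤ)) (k : ℤ) (h₁ h₂ h₃ : ℝ → ℂ) : ℝ → ℂ :=
  fun x => ∑' p : ℤ × ℤ × ℤ,
    Set.indicator S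
      (fun p => P φ₀ k (T3 (P φ₀ p.1 h₁) (P φ₀ p.2.1 h₂) (P φ₀ p.2.2 h₃)) x) p

end Muskat

namespace Muskat

/-- Plancherel for `L¹ ∩ L²`. -/
lemma plancherel (h : ℝ → ℂ) (h1 : Integrable h) (h2 : MemLp h 2 volume) :
    eLpNorm (𝓕 h) 2 volume = eLpNorm h 2 volume := by
  have hcont : Continuous (𝓕 h) :=
    VectorFourier.fourierIntegral_continuous Real.continuous_fourierChar
      (by exact continuous_inner) h1
  set H : Lp ℂ 2 (volume : Measure ℝ) := h2.toLp h with hH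
  have key : ((𝓕 H : Lp ℂ 2 (volume : Measure ℝ)) : ℝ → ℂ) =ᵐ[volume] 𝓕 h := by
    apply ae_eq_of_integral_contDiff_smul_eq
    · exact (Lp.memLp _).locallyIntegrable (by norm_num)
    · exact hcont.locallyIntegrable
    intro g hg hgs
    have hg' : ContDiff ℝ (⊤ : ℕ∞) (fun x => (g x : ℂ)) := Complex.ofRealCLM.contDiff.comp hg
    have hgs' : HasCompactSupport (fun x => (g x : ℂ)) := hgs.comp_left (g := fun r : ℝ => (r : ℂ)) (by simp)
    set ψ := hgs'.toSchwartzMap hg' with hψ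
    have e1 : ((𝓕 H : Lp ℂ 2 (volume : Measure ℝ)) : TemperedDistribution ℝ ℂ) ψ
        = (H : TemperedDistribution ℝ ℂ) (𝓕 ψ) := by
      rw [← Lp.fourier_toTemperedDistribution_eq]; rfl
    rw [Lp.toTemperedDistribution_apply, Lp.toTemperedDistribution_apply] at e1
    have e2 : ∫ x, (𝓕 ψ) x • H x = ∫ x, (𝓕 ψ) x • h x := by
      apply integral_congr_ae
      filter_upwards [h2.coeFn_toLp] with x hx
      rw [hH, hx]
    have e3 := VectorFourier.integral_fourierIntegral_smul_eq_flip (L := innerₗ ℝ)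
      (μ := volume) (ν := volume) Real.continuous_fourierChar (by exact continuous_inner)
      ψ.integrable h1
    have e4 : ∫ x, (𝓕 ψ) x • h x = ∫ x, ψ x • 𝓕 h x := by
      rw [SchwartzMap.fourier_coe]
      simpa using! e3
    rw [e2, e4] at e1
    simpa [hψ] using e1
  rw [← eLpNorm_congr_ae key]
  have := Lp.norm_fourier_eq H
  rw [Lp.norm_def, Lp.norm_def, ENNReal.toReal_eq_toReal_iff' (Lp.eLpNorm_ne_top _) (Lp.eLpNorm_ne_top _)] at this
  rw [this]
  exact eLpNorm_congr_ae h2.coeFn_toLp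

lemma plancherelInv (h : ℝ → ℂ) (h1 : Integrable h) (h2 : MemLp h 2 volume) :
    eLpNorm (𝓕⁻ h) 2 volume = eLpNorm h 2 volume := by
  have e : (𝓕⁻ h : ℝ → ℂ) = (𝓕 h) ∘ (fun x : ℝ => -x) := by
    ext x; rw [Real.fourierInv_eq_fourier_neg]; rfl
  have hcont : Continuous (𝓕 h) :=
    VectorFourier.fourierIntegral_continuous Real.continuous_fourierChar
      (by exact continuous_inner) h1
  rw [e, eLpNorm_comp_measurePreserving hcont.aestronglyMeasurable
    (Measure.measurePreserving_neg volume), plancherel h h1 h2]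

lemma fourier_cont {h : ℝ → ℂ} (h1 : Integrable h) : Continuous (𝓕 h) :=
  VectorFourier.fourierIntegral_continuous Real.continuous_fourierChar
      (by exact continuous_inner) h1

lemma inv_formula (g : ℝ → ℂ) (x : ℝ) :
    𝓕⁻ g x = ∫ ξ : ℝ, Complex.exp (2 * π * ξ * x * I) * g ξ := by
  rw [Real.fourierInv_eq']
  congr 1; ext ξ
  simp only [smul_eq_mul]
  congr 2
  simp; ring

lemma fourier_formula (g : ℝ → ℂ) (x : ℝ) :
    𝓕 g x = ∫ ξ : ℝ, Complex.exp (-(2 * π * ξ * x * I)) * g ξ := by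
  rw [Real.fourier_eq']
  congr 1; ext ξ
  simp only [smul_eq_mul]
  congr 2
  simp; ring

lemma norm_e (r s : ℝ) : ‖Complex.exp (2 * π * r * s * I)‖ = 1 := by
  have : (2 * π * r * s * I : ℂ) = ((2 * π * r * s : ℝ) : ℂ) * I := by push_cast; ring
  rw [this, Complex.norm_exp_ofReal_mul_I]

lemma inv_cont {h : ℝ → ℂ} (h1 : Integrable h) : Continuous (𝓕⁻ h) := by
  have e : (𝓕⁻ h : ℝ → ℂ) = (𝓕 h) ∘ (fun x : ℝ => -x) := by
    ext x; rw [Real.fourierInv_eq_fourier_neg]; rfl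
  rw [e]
  exact (fourier_cont h1).comp continuous_neg

lemma inv_bdd (h : ℝ → ℂ) (x : ℝ) : ‖𝓕⁻ h x‖ ≤ ∫ ξ, ‖h ξ‖ := by
  rw [inv_formula]
  refine (norm_integral_le_integral_norm _).trans (le_of_eq ?_)
  congr 1; ext ξ
  rw [norm_mul, norm_e, one_mul]

lemma inv_deriv {g : ℝ → ℂ} (h1 : Integrable g) (h2 : Integrable (fun ξ : ℝ => (2 * π * I * ξ) * g ξ))
    (x : ℝ) : HasDerivAt (𝓕⁻ g) (𝓕⁻ (fun ξ : ℝ => (2 * π * I * ξ) * g ξ) x) x := by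
  have e : ∀ h : ℝ → ℂ, (𝓕⁻ h : ℝ → ℂ) = fun x => (𝓕 h) (-x) := by
    intro h; ext x; rw [Real.fourierInv_eq_fourier_neg]
  have h3 : Integrable (fun ξ : ℝ => ξ • g ξ) := by
    have := h2.const_mul ((2 * π * I)⁻¹ : ℂ)
    refine this.congr (Eventually.of_forall fun ξ => ?_)
    have : (2 * π * I : ℂ) ≠ 0 := by simp [Real.pi_ne_zero]
    simp only [Complex.real_smul]
    rw [← mul_assoc, ← mul_assoc, inv_mul_cancel₀ this, one_mul]
  have := (Real.hasDerivAt_fourier h1 h3 (-x)).scomp x (hasDerivAt_neg x)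
  rw [e, e]
  convert! this using 1
  simp only [Real.fourier_eq', neg_smul, one_smul]
  rw [← integral_neg]
  congr 1; ext ξ
  simp

/-- Minkowski's integral inequality for exponents `1`, `2`, `∞`. -/
lemma minkowski {p : ℝ≥0∞} (hp : p = 1 ∨ p = 2 ∨ p = ⊤) {μ : Measure ℝ} [SFinite μ]
    {F : ℝ → ℝ → ℝ≥0∞} (hF : Measurable (Function.uncurry F)) {N : ℝ → ℝ≥0∞} (hN : Measurable N)
    (hb : ∀ᵐ a ∂μ, eLpNorm (fun x => F x a) p volume ≤ N a) :
    eLpNorm (fun x => ∫⁻ a, F x a ∂μ) p volume ≤ ∫⁻ a, N a ∂μ := by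
  have hFa : ∀ a, Measurable (fun x => F x a) := fun a => hF.comp (by fun_prop : Measurable fun x : ℝ => (x, a))
  have hFx : ∀ x, Measurable (fun a => F x a) := fun x => hF.comp (by fun_prop : Measurable fun a : ℝ => (x, a))
  rcases hp with rfl | rfl | rfl
  · simp only [eLpNorm_one_eq_lintegral_enorm, enorm_eq_self] at hb ⊢
    rw [lintegral_lintegral_swap hF.aemeasurable]
    exact lintegral_mono_ae hb
  · have sq : ∀ h : ℝ → ℝ≥0∞, eLpNorm h 2 volume ^ 2 = ∫⁻ x, h x * h x := by
      intro h
      rw [eLpNorm_eq_lintegral_rpow_enorm_toReal (by norm_num) (by norm_num)]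
      rw [← ENNReal.rpow_natCast, ← ENNReal.rpow_mul]
      simp [← pow_two]
    rw [← ENNReal.pow_le_pow_left_iff (two_ne_zero), sq]
    have e1 : ∀ x, (∫⁻ a, F x a ∂μ) * (∫⁻ a, F x a ∂μ) = ∫⁻ a, ∫⁻ b, F x a * F x b ∂μ ∂μ := by
      intro x
      rw [← lintegral_mul_const _ (hFx x)]
      congr 1; ext a
      rw [lintegral_const_mul _ (hFx x)]
    simp_rw [e1]
    have m3 : Measurable (fun q : (ℝ × ℝ) × ℝ => F q.1.1 q.1.2 * F q.1.1 q.2) := by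
      apply Measurable.mul
      · exact hF.comp (by fun_prop : Measurable fun q : (ℝ × ℝ) × ℝ => (q.1.1, q.1.2))
      · exact hF.comp (by fun_prop : Measurable fun q : (ℝ × ℝ) × ℝ => (q.1.1, q.2))
    rw [lintegral_lintegral_swap (m3.lintegral_prod_right' ).aemeasurable]
    have e2 : ∀ a, ∫⁻ x, ∫⁻ b, F x a * F x b ∂μ = ∫⁻ b, (∫⁻ x, F x a * F x b) ∂μ := by
      intro a
      rw [lintegral_lintegral_swap]
      exact (m3.comp (by fun_prop : Measurable fun q : ℝ × ℝ => ((q.1, a), q.2))).aemeasurable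
    simp_rw [e2]
    have e3 : ∀ a b, ∫⁻ x, F x a * F x b ≤ eLpNorm (fun x => F x a) 2 volume * eLpNorm (fun x => F x b) 2 volume := by
      intro a b
      have := ENNReal.lintegral_mul_le_Lp_mul_Lq volume (Real.HolderConjugate.two_two)
        (hFa a).aemeasurable (hFa b).aemeasurable
      rw [eLpNorm_eq_lintegral_rpow_enorm_toReal (by norm_num) (by norm_num),
        eLpNorm_eq_lintegral_rpow_enorm_toReal (by norm_num) (by norm_num)]
      simpa using this
    calc ∫⁻ a, ∫⁻ b, (∫⁻ x, F x a * F x b) ∂μ ∂μ ≤ ∫⁻ a, ∫⁻ b, N a * N b ∂μ ∂μ := by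
          apply lintegral_mono_ae
          filter_upwards [hb] with a ha
          apply lintegral_mono_ae
          filter_upwards [hb] with b hb'
          exact (e3 a b).trans (mul_le_mul' ha hb')
      _ = (∫⁻ a, N a ∂μ) ^ 2 := by
          simp_rw [lintegral_const_mul _ hN]
          rw [lintegral_mul_const _ hN, pow_two]
  · simp only [eLpNorm_exponent_top, eLpNormEssSup, enorm_eq_self] at hb ⊢
    have h1 : ∀ᵐ a ∂μ, ∀ᵐ x, F x a ≤ N a := by
      filter_upwards [hb] with a ha
      filter_upwards [ENNReal.ae_le_essSup (fun x => F x a)] with x hx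
      exact hx.trans ha
    have h2 : ∀ᵐ x, ∀ᵐ a ∂μ, F x a ≤ N a := by
      rw [Measure.ae_ae_comm]
      · exact h1
      · exact measurableSet_le hF (hN.comp measurable_snd)
    refine essSup_le_of_ae_le (hfbdd := by isBoundedDefault) _ ?_
    filter_upwards [h2] with x hx
    exact lintegral_mono_ae hx

lemma minkowski' {p : ℝ≥0∞} (hp : p = 1 ∨ p = 2 ∨ p = ⊤) {μ : Measure ℝ} [SFinite μ]
    {F : ℝ → ℝ → ℂ} (hF : Measurable (Function.uncurry F)) {N : ℝ → ℝ≥0∞} (hN : Measurable N)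
    (hb : ∀ᵐ a ∂μ, eLpNorm (fun x => F x a) p volume ≤ N a) :
    eLpNorm (fun x => ∫ a, F x a ∂μ) p volume ≤ ∫⁻ a, N a ∂μ := by
  refine le_trans ?_ (minkowski (F := fun x a => ‖F x a‖ₑ) hp hF.enorm hN ?_)
  · apply eLpNorm_mono_enorm
    intro x
    rw [enorm_eq_self]
    exact enorm_integral_le_lintegral_enorm _
  · filter_upwards [hb] with a ha
    rwa [eLpNorm_enorm]

lemma eLpNorm_shift {u : ℝ → ℂ} (hu : Continuous u) (q : ℝ≥0∞) (a : ℝ) :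
    eLpNorm (fun x => u (x - a)) q volume = eLpNorm u q volume :=
  eLpNorm_comp_measurePreserving hu.aestronglyMeasurable (measurePreserving_sub_right volume a)

lemma ftc_seg {v u : ℝ → ℂ} (hv : ∀ x, HasDerivAt v (u x) x) (hu : Continuous u) (x α : ℝ) :
    v x - v (x - α) = α * ∫ s in Icc (0:ℝ) 1, u (x - s * α) := by
  have h1 : ∀ s ∈ uIcc (0:ℝ) 1, HasDerivAt (fun s : ℝ => - v (x - s * α)) (α * u (x - s * α)) s := by
    intro s _
    have := (hv (x - s * α)).scomp s (((hasDerivAt_id s).mul_const α).const_sub x)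
    have := this.neg
    convert! this using 1
    simp
  have h2 := intervalIntegral.integral_eq_sub_of_hasDerivAt h1
    (Continuous.intervalIntegrable (by fun_prop) _ _)
  rw [integral_Icc_eq_integral_Ioc, ← intervalIntegral.integral_of_le zero_le_one,
    ← intervalIntegral.integral_const_mul, h2]
  simp; ring

lemma diff_bound {q : ℝ≥0∞} (hq : q = 1 ∨ q = 2 ∨ q = ⊤) {v u : ℝ → ℂ}
    (hv : ∀ x, HasDerivAt v (u x) x) (hu : Continuous u) (α : ℝ) :
    eLpNorm (fun x => v x - v (x - α)) q volume ≤ ENNReal.ofReal |α| * eLpNorm u q volume := by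
  have e : (fun x => v x - v (x - α)) = (α : ℂ) • fun x => ∫ s in Icc (0:ℝ) 1, u (x - s * α) := by
    ext x; simp [ftc_seg hv hu]
  rw [e, eLpNorm_const_smul]
  have : ‖(α : ℂ)‖ₑ = ENNReal.ofReal |α| := by
    rw [← ofReal_norm]; simp
  rw [this]
  gcongr
  refine (minkowski' (F := fun x s => u (x - s * α)) (N := fun _ => eLpNorm u q volume) hq ?_ measurable_const ?_).trans ?_
  · exact Continuous.measurable (by unfold Function.uncurry; fun_prop)
  · exact Eventually.of_forall fun s => (eLpNorm_shift hu q _).le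
  · simp

lemma diff2_bound {q : ℝ≥0∞} (hq : q = 1 ∨ q = 2 ∨ q = ⊤) {v u u' : ℝ → ℂ}
    (hv : ∀ x, HasDerivAt v (u x) x) (hu : ∀ x, HasDerivAt u (u' x) x) (hu' : Continuous u') (α : ℝ) :
    eLpNorm (fun x => v x - v (x - α) - α * u x) q volume ≤
      ENNReal.ofReal |α| * (ENNReal.ofReal |α| * eLpNorm u' q volume) := by
  have huc : Continuous u := continuous_iff_continuousAt.2 fun x => (hu x).continuousAt
  have e : (fun x => v x - v (x - α) - α * u x) =
      (-α : ℂ) • fun x => ∫ s in Icc (0:ℝ) 1, (u x - u (x - s * α)) := by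
    ext x
    have hi : IntegrableOn (fun s => u (x - s * α)) (Icc (0:ℝ) 1) :=
      (Continuous.continuousOn (by fun_prop)).integrableOn_compact isCompact_Icc
    rw [ftc_seg hv huc, Pi.smul_apply, integral_sub (by simp) hi]
    simp
    ring
  rw [e, eLpNorm_const_smul]
  have : ‖(-α : ℂ)‖ₑ = ENNReal.ofReal |α| := by
    rw [← ofReal_norm]; simp
  rw [this]
  gcongr
  refine (minkowski' (F := fun x s => u x - u (x - s * α))
    (N := fun _ => ENNReal.ofReal |α| * eLpNorm u' q volume) hq ?_ measurable_const ?_).trans ?_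
  · exact Continuous.measurable (by unfold Function.uncurry; fun_prop)
  · rw [ae_restrict_iff' measurableSet_Icc]
    refine Eventually.of_forall fun s hs => (diff_bound hq hu hu' _).trans ?_
    refine mul_le_mul_left (ENNReal.ofReal_le_ofReal ?_) _
    rw [abs_mul, abs_of_nonneg hs.1]
    exact mul_le_of_le_one_left (abs_nonneg _) hs.2
  · simp

/-- difference quotient -/
def Q (u : ℝ → ℂ) (x α : ℝ) : ℂ := (α:ℂ)⁻¹ * (u x - u (x - α))

lemma Q_meas {u : ℝ → ℂ} (hu : Continuous u) : Measurable (Function.uncurry (Q u)) := by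
  unfold Q Function.uncurry
  apply Measurable.mul
  · fun_prop
  · exact Continuous.measurable (by fun_prop)

lemma Q_meas_x {u : ℝ → ℂ} (hu : Continuous u) (α : ℝ) : Measurable (fun x => Q u x α) :=
  (Q_meas hu).comp (by fun_prop : Measurable fun x : ℝ => (x, α))

lemma Q_meas_a {u : ℝ → ℂ} (hu : Continuous u) (x : ℝ) : Measurable (fun α => Q u x α) :=
  (Q_meas hu).comp (by fun_prop : Measurable fun α : ℝ => (x, α))

lemma enorm_inv (α : ℝ) : ‖(α:ℂ)⁻¹‖ₑ = ENNReal.ofReal (1 / |α|) := by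
  rw [← ofReal_norm]; simp

lemma qb1 {q : ℝ≥0∞} (hq : q = 1 ∨ q = 2 ∨ q = ⊤) {v u : ℝ → ℂ}
    (hv : ∀ x, HasDerivAt v (u x) x) (hu : Continuous u) (α : ℝ) :
    eLpNorm (fun x => Q v x α) q volume ≤ eLpNorm u q volume := by
  have : (fun x => Q v x α) = (α:ℂ)⁻¹ • fun x => v x - v (x - α) := by ext x; simp [Q]
  rw [this, eLpNorm_const_smul, enorm_inv]
  calc _ ≤ ENNReal.ofReal (1 / |α|) * (ENNReal.ofReal |α| * eLpNorm u q volume) := by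
        gcongr; exact diff_bound hq hv hu α
    _ ≤ 1 * eLpNorm u q volume := by
        rw [← mul_assoc, ← ENNReal.ofReal_mul (by positivity)]
        gcongr
        rw [ENNReal.ofReal_le_one]
        rw [one_div]; exact inv_mul_le_one
    _ = _ := one_mul _

lemma qb2 {q : ℝ≥0∞} (hq : 1 ≤ q) {u : ℝ → ℂ} (hu : Continuous u) (α : ℝ) :
    eLpNorm (fun x => Q u x α) q volume ≤ ENNReal.ofReal (2 / |α|) * eLpNorm u q volume := by
  have : (fun x => Q u x α) = (α:ℂ)⁻¹ • (u - fun x => u (x - α)) := by ext x; simp [Q]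
  rw [this, eLpNorm_const_smul, enorm_inv]
  have h1 := eLpNorm_sub_le hu.aestronglyMeasurable
    (show Continuous fun x => u (x - α) by fun_prop).aestronglyMeasurable (μ := volume) hq
  rw [eLpNorm_shift hu] at h1
  calc _ ≤ ENNReal.ofReal (1 / |α|) * (eLpNorm u q volume + eLpNorm u q volume) := by gcongr
    _ = _ := by
      rw [← two_mul, ← mul_assoc]
      congr 1
      rw [show (2 / |α|) = 1 / |α| * 2 by ring, ENNReal.ofReal_mul (by positivity)]
      norm_num

lemma qb3 {q : ℝ≥0∞} (hq : q = 1 ∨ q = 2 ∨ q = ⊤) {v u u' : ℝ → ℂ}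
    (hv : ∀ x, HasDerivAt v (u x) x) (hu : ∀ x, HasDerivAt u (u' x) x) (hu' : Continuous u')
    (α : ℝ) (hα : α ≠ 0) :
    eLpNorm (fun x => Q v x α - u x) q volume ≤ ENNReal.ofReal |α| * eLpNorm u' q volume := by
  have hα' : (α : ℂ) ≠ 0 := by exact_mod_cast hα
  have : (fun x => Q v x α - u x) = (α:ℂ)⁻¹ • (fun x => v x - v (x - α) - α * u x) := by
    ext x; simp [Q]; field_simp
  rw [this, eLpNorm_const_smul, enorm_inv]
  calc _ ≤ _ := mul_le_mul_right (diff2_bound hq hv hu hu' α) _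
    _ = _ := by
      rw [← mul_assoc, ← ENNReal.ofReal_mul (by positivity), one_div,
        inv_mul_cancel₀ (abs_ne_zero.2 hα)]
      simp

lemma Q_le {u u' : ℝ → ℂ} {M : ℝ} (h : ∀ x, HasDerivAt u (u' x) x) (hb : ∀ x, ‖u' x‖ ≤ M)
    (x α : ℝ) : ‖Q u x α‖ ≤ M := by
  have hM : 0 ≤ M := (norm_nonneg _).trans (hb 0)
  have h1 : ‖u x - u (x - α)‖ ≤ M * ‖x - (x - α)‖ :=
    Convex.norm_image_sub_le_of_norm_hasDerivWithin_le (s := univ)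
      (fun y _ => (h y).hasDerivWithinAt) (fun y _ => hb y) convex_univ (mem_univ _) (mem_univ _)
  rw [Q, norm_mul, norm_inv, Complex.norm_real]
  simp only [sub_sub_cancel] at h1
  calc _ ≤ ‖α‖⁻¹ * (M * ‖α‖) := by gcongr
    _ = M * (‖α‖⁻¹ * ‖α‖) := by ring
    _ ≤ M := mul_le_of_le_one_right hM inv_mul_le_one

lemma Q_sq {u u' : ℝ → ℂ} {M : ℝ} (h : ∀ x, HasDerivAt u (u' x) x) (hb : ∀ x, ‖u' x‖ ≤ M)
    (hb0 : ∀ x, ‖u x‖ ≤ M) (x α : ℝ) : ‖Q u x α‖ ^ 2 ≤ 5 * M ^ 2 * (1 + α ^ 2)⁻¹ := by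
  have hM : 0 ≤ M := (norm_nonneg _).trans (hb 0)
  have h1 := Q_le h hb x α
  have h2 : ‖Q u x α‖ * |α| ≤ 2 * M := by
    rw [Q, norm_mul, norm_inv, Complex.norm_real]
    have : ‖u x - u (x - α)‖ ≤ 2 * M := by
      refine (norm_sub_le _ _).trans ?_
      linarith [hb0 x, hb0 (x - α)]
    calc ‖α‖⁻¹ * ‖u x - u (x - α)‖ * |α| = (|α|⁻¹ * |α|) * ‖u x - u (x - α)‖ := by
          rw [Real.norm_eq_abs]; ring
      _ ≤ 1 * (2 * M) := by gcongr; exact inv_mul_le_one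
      _ = _ := one_mul _
  rw [← div_eq_mul_inv, le_div_iff₀ (by positivity)]
  have h3 : ‖Q u x α‖ ^ 2 ≤ M ^ 2 := by gcongr
  have h4 : (‖Q u x α‖ * |α|) ^ 2 ≤ (2 * M) ^ 2 := by gcongr
  rw [mul_pow, sq_abs] at h4
  nlinarith

lemma Q_prod {u2 u2' u3 u3' : ℝ → ℂ} {M : ℝ} (h2 : ∀ x, HasDerivAt u2 (u2' x) x)
    (hb2 : ∀ x, ‖u2' x‖ ≤ M) (hb20 : ∀ x, ‖u2 x‖ ≤ M)
    (h3 : ∀ x, HasDerivAt u3 (u3' x) x) (hb3 : ∀ x, ‖u3' x‖ ≤ M) (hb30 : ∀ x, ‖u3 x‖ ≤ M)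
    (x α : ℝ) (c : ℂ) (hc : ‖c‖ ≤ M) : ‖c * Q u2 x α * Q u3 x α‖ ≤ 5 * M ^ 3 * (1 + α ^ 2)⁻¹ := by
  have hM : 0 ≤ M := (norm_nonneg _).trans (hb2 0)
  have e2 := Q_sq h2 hb2 hb20 x α
  have e3 := Q_sq h3 hb3 hb30 x α
  have e : ‖Q u2 x α‖ * ‖Q u3 x α‖ ≤ 5 * M ^ 2 * (1 + α ^ 2)⁻¹ := by
    nlinarith [sq_nonneg (‖Q u2 x α‖ - ‖Q u3 x α‖)]
  rw [norm_mul, norm_mul, mul_assoc]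
  calc _ ≤ M * (5 * M ^ 2 * (1 + α ^ 2)⁻¹) := by gcongr
    _ = _ := by ring

lemma holder_mul {p q r : ℝ≥0∞} [ENNReal.HolderTriple p q r] {f g : ℝ → ℂ} (hf : Measurable f)
    (hg : Measurable g) :
    eLpNorm (fun x => f x * g x) r volume ≤ eLpNorm f p volume * eLpNorm g q volume :=
  eLpNorm_smul_le_mul_eLpNorm (φ := f) (f := g) hg.aestronglyMeasurable hf.aestronglyMeasurable

lemma poisson_int {R : ℝ} (hR : 0 < R) :
    ∫⁻ α : ℝ, ENNReal.ofReal ((1 + (α / R) ^ 2)⁻¹) = ENNReal.ofReal (R * π) := by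
  rw [← ofReal_integral_eq_lintegral_ofReal]
  · congr 1
    have := Measure.integral_comp_div (fun x : ℝ => (1 + x ^ 2)⁻¹) R
    rw [this, integral_univ_inv_one_add_sq, abs_of_pos hR, smul_eq_mul]
  · exact integrable_inv_one_add_sq.comp_div hR.ne'
  · exact Eventually.of_forall fun x => by positivity

set_option maxHeartbeats 2000000 in
lemma core {p q : ℝ≥0∞} (hp : p = 1 ∨ p = 2) (hq : q = 2 ∨ q = ⊤) [ENNReal.HolderTriple 2 q p]
    {u1 u1' v2 u2 u2' v3 u3 u3' : ℝ → ℂ} {M R A : ℝ} {B : ℝ≥0∞} (hR : 0 < R) (hA : 0 ≤ A)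
    (hu1 : ∀ x, HasDerivAt u1 (u1' x) x) (bu1' : ∀ x, ‖u1' x‖ ≤ M)
    (hv2 : ∀ x, HasDerivAt v2 (u2 x) x) (hu2 : ∀ x, HasDerivAt u2 (u2' x) x)
    (cu2' : Continuous u2') (bv2 : ∀ x, ‖v2 x‖ ≤ M) (bu2 : ∀ x, ‖u2 x‖ ≤ M)
    (hv3 : ∀ x, HasDerivAt v3 (u3 x) x) (hu3 : ∀ x, HasDerivAt u3 (u3' x) x)
    (cu3' : Continuous u3') (bv3 : ∀ x, ‖v3 x‖ ≤ M) (bu3 : ∀ x, ‖u3 x‖ ≤ M)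
    (hW : eLpNorm (fun x => ∫ α in Ioc (-R) R, Q u1 x α) 2 volume ≤ B * eLpNorm u1 2 volume)
    (n2 : eLpNorm u2' q volume ≤ ENNReal.ofReal (A / R) * eLpNorm u2 q volume)
    (n3 : eLpNorm u3' ⊤ volume ≤ ENNReal.ofReal (A / R) * eLpNorm u3 ⊤ volume)
    (far : eLpNorm v2 q volume ≤ ENNReal.ofReal (A * R) * eLpNorm u2 q volume ∨
      eLpNorm v3 ⊤ volume ≤ ENNReal.ofReal (A * R) * eLpNorm u3 ⊤ volume) :
    eLpNorm (fun x => ∫ α, Q u1 x α * Q v2 x α * Q v3 x α) p volume ≤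
      (B + ENNReal.ofReal (8 * A + 8 * A * π)) *
        (eLpNorm u1 2 volume * eLpNorm u2 q volume * eLpNorm u3 ⊤ volume) := by
  have cu1 : Continuous u1 := continuous_iff_continuousAt.2 fun x => (hu1 x).continuousAt
  have cu2 : Continuous u2 := continuous_iff_continuousAt.2 fun x => (hu2 x).continuousAt
  have cu3 : Continuous u3 := continuous_iff_continuousAt.2 fun x => (hu3 x).continuousAt
  have cv2 : Continuous v2 := continuous_iff_continuousAt.2 fun x => (hv2 x).continuousAt
  have cv3 : Continuous v3 := continuous_iff_continuousAt.2 fun x => (hv3 x).continuousAt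
  have hp1 : 1 ≤ p := by rcases hp with rfl | rfl <;> norm_num
  have hq1 : 1 ≤ q := by rcases hq with rfl | rfl <;> norm_num
  have hp' : p = 1 ∨ p = 2 ∨ p = ⊤ := by tauto
  have hq' : q = 1 ∨ q = 2 ∨ q = ⊤ := by tauto
  set T := eLpNorm u1 2 volume * eLpNorm u2 q volume * eLpNorm u3 ⊤ volume with hT
  set s := Ioc (-R) R with hs
  have ms : MeasurableSet s := measurableSet_Ioc
  let W : ℝ → ℂ := fun x => ∫ α in s, Q u1 x α
  let E : ℝ → ℝ → ℂ := fun x α => Q u1 x α * (Q v2 x α * Q v3 x α - u2 x * u3 x)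
  let G : ℝ → ℝ → ℂ := fun x α => Q u1 x α * (Q v2 x α * Q v3 x α)
  have mQ1 := Q_meas cu1
  have mQ2 := Q_meas cv2
  have mQ3 := Q_meas cv3
  have mG : Measurable (Function.uncurry G) := mQ1.mul (mQ2.mul mQ3)
  have mE : Measurable (Function.uncurry E) := by
    refine mQ1.mul ((mQ2.mul mQ3).sub ?_)
    exact Continuous.measurable (by fun_prop)
  have intG : ∀ x, Integrable (fun α => G x α) := by
    intro x
    refine (integrable_inv_one_add_sq.const_mul (5 * M ^ 3)).mono'
      (mG.comp (by fun_prop : Measurable fun α : ℝ => (x, α))).aestronglyMeasurable ?_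
    refine Eventually.of_forall fun α => ?_
    have := Q_prod hv2 bu2 bv2 hv3 bu3 bv3 x α _ (Q_le hu1 bu1' x α)
    simpa [G, mul_assoc] using this
  have intQ : ∀ x, IntegrableOn (fun α => Q u1 x α) s := by
    intro x
    refine Measure.integrableOn_of_bounded (M := M) (by simp [hs]) (Q_meas_a cu1 x).aestronglyMeasurable ?_
    exact Eventually.of_forall fun α => Q_le hu1 bu1' x α
  have dec : (fun x => ∫ α, Q u1 x α * Q v2 x α * Q v3 x α) =
      ((fun x => W x * (u2 x * u3 x)) + fun x => ∫ α in s, E x α) + fun x => ∫ α in sᶜ, G x α := by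
    ext x
    simp only [Pi.add_apply]
    have e1 : ∫ α, Q u1 x α * Q v2 x α * Q v3 x α = ∫ α, G x α := by simp only [G, mul_assoc]
    rw [e1, ← integral_add_compl ms (intG x)]
    congr 1
    have e2 : ∀ α, E x α = G x α - Q u1 x α * (u2 x * u3 x) := by
      intro α; simp only [E, G]; ring
    simp only [e2]
    rw [integral_sub (intG x).integrableOn ((intQ x).mul_const _), integral_mul_const]
    simp only [W]; ring
  have smW : Measurable W := by
    have : StronglyMeasurable W := mQ1.stronglyMeasurable.integral_prod_right' (ν := volume.restrict s)
    exact this.measurable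
  have smE : StronglyMeasurable (fun x => ∫ α in s, E x α) :=
    mE.stronglyMeasurable.integral_prod_right' (ν := volume.restrict s)
  have smG : StronglyMeasurable (fun x => ∫ α in sᶜ, G x α) :=
    mG.stronglyMeasurable.integral_prod_right' (ν := volume.restrict sᶜ)
  have b23 : eLpNorm (fun x => u2 x * u3 x) q volume ≤ eLpNorm u2 q volume * eLpNorm u3 ⊤ volume :=
    holder_mul cu2.measurable cu3.measurable
  have B1 : eLpNorm (fun x => W x * (u2 x * u3 x)) p volume ≤ B * T := by
    calc _ ≤ eLpNorm W 2 volume * eLpNorm (fun x => u2 x * u3 x) q volume :=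
          holder_mul smW (by fun_prop)
      _ ≤ (B * eLpNorm u1 2 volume) * (eLpNorm u2 q volume * eLpNorm u3 ⊤ volume) := by gcongr
      _ = _ := by rw [hT]; ring
  have B2 : eLpNorm (fun x => ∫ α in s, E x α) p volume ≤ ENNReal.ofReal (8 * A) * T := by
    refine (minkowski' (N := fun _ => ENNReal.ofReal (4 * A / R) * T) hp' mE measurable_const ?_).trans ?_
    · have h0 : ∀ᵐ α : ℝ ∂(volume.restrict s), α ≠ 0 := by
        apply ae_restrict_of_ae
        simp [ae_iff]
      filter_upwards [h0] with α hα
      have hS : eLpNorm (fun x => Q v2 x α * Q v3 x α - u2 x * u3 x) q volume ≤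
          ENNReal.ofReal (|α| * (2 * A / R)) * (eLpNorm u2 q volume * eLpNorm u3 ⊤ volume) := by
        have e : (fun x => Q v2 x α * Q v3 x α - u2 x * u3 x) =
            (fun x => (Q v2 x α - u2 x) * Q v3 x α) + fun x => u2 x * (Q v3 x α - u3 x) := by
          ext x; simp only [Pi.add_apply]; ring
        have m2 := Q_meas_x cv2 α
        have m3 := Q_meas_x cv3 α
        have m2' := cu2.measurable
        have m3' := cu3.measurable
        rw [e]
        refine (eLpNorm_add_le (by fun_prop) (by fun_prop) hq1).trans ?_
        have i1 : eLpNorm (fun x => (Q v2 x α - u2 x) * Q v3 x α) q volume ≤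
            (ENNReal.ofReal |α| * (ENNReal.ofReal (A / R) * eLpNorm u2 q volume)) * eLpNorm u3 ⊤ volume := by
          refine (holder_mul (p := q) (q := ⊤) (by fun_prop) m3).trans ?_
          gcongr
          · exact (qb3 hq' hv2 hu2 cu2' α hα).trans (by gcongr)
          · exact qb1 (by tauto) hv3 cu3 α
        have i2 : eLpNorm (fun x => u2 x * (Q v3 x α - u3 x)) q volume ≤
            eLpNorm u2 q volume * (ENNReal.ofReal |α| * (ENNReal.ofReal (A / R) * eLpNorm u3 ⊤ volume)) := by
          refine (holder_mul (p := q) (q := ⊤) m2' (by fun_prop)).trans ?_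
          gcongr
          exact (qb3 (by tauto) hv3 hu3 cu3' α hα).trans (by gcongr)
        refine (add_le_add i1 i2).trans (le_of_eq ?_)
        rw [ENNReal.ofReal_mul (by positivity), show 2 * A / R = 2 * (A / R) by ring,
          ENNReal.ofReal_mul (by norm_num)]
        norm_num
        ring
      calc _ ≤ eLpNorm (fun x => Q u1 x α) 2 volume *
            eLpNorm (fun x => Q v2 x α * Q v3 x α - u2 x * u3 x) q volume := by
            have m2 := Q_meas_x cv2 α
            have m3 := Q_meas_x cv3 α
            have m2' := cu2.measurable
            have m3' := cu3.measurable
            exact holder_mul (Q_meas_x cu1 α) (by fun_prop)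
        _ ≤ (ENNReal.ofReal (2 / |α|) * eLpNorm u1 2 volume) *
            (ENNReal.ofReal (|α| * (2 * A / R)) * (eLpNorm u2 q volume * eLpNorm u3 ⊤ volume)) := by
            gcongr
            exact qb2 (by norm_num) cu1 α
        _ = (ENNReal.ofReal (2 / |α|) * ENNReal.ofReal (|α| * (2 * A / R))) * T := by rw [hT]; ring
        _ = _ := by
            rw [← ENNReal.ofReal_mul (by positivity)]
            congr 2
            have := abs_ne_zero.2 hα
            field_simp; ring
    · rw [lintegral_const, Measure.restrict_apply_univ, hs, Real.volume_Ioc]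
      rw [mul_right_comm, ← ENNReal.ofReal_mul (by positivity)]
      apply le_of_eq
      congr 2
      field_simp; ring
  have B3 : eLpNorm (fun x => ∫ α in sᶜ, G x α) p volume ≤ ENNReal.ofReal (8 * A * π) * T := by
    refine (minkowski' (N := fun α => ENNReal.ofReal (8 * A / R) *
      ENNReal.ofReal ((1 + (α / R) ^ 2)⁻¹) * T) hp' mG (by fun_prop) ?_).trans ?_
    · rw [ae_restrict_iff' ms.compl]
      refine Eventually.of_forall fun α hα => ?_
      have hα' : R ≤ |α| := by
        rw [hs, mem_compl_iff, mem_Ioc, not_and_or, not_lt, not_le] at hα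
        rcases hα with h | h
        · rw [le_abs]; right; linarith
        · rw [le_abs]; left; linarith
      have hα0 : 0 < |α| := hR.trans_le hα'
      have m2 := Q_meas_x cv2 α
      have m3 := Q_meas_x cv3 α
      have hS : eLpNorm (fun x => Q v2 x α * Q v3 x α) q volume ≤
          ENNReal.ofReal (2 / |α| * (A * R)) * (eLpNorm u2 q volume * eLpNorm u3 ⊤ volume) := by
        refine (holder_mul (p := q) (q := ⊤) m2 m3).trans ?_
        rw [ENNReal.ofReal_mul (by positivity)]
        rcases far with far | far
        · calc _ ≤ (ENNReal.ofReal (2 / |α|) * (ENNReal.ofReal (A * R) * eLpNorm u2 q volume)) *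
                eLpNorm u3 ⊤ volume := by
                gcongr
                · exact (qb2 hq1 cv2 α).trans (by gcongr)
                · exact qb1 (by tauto) hv3 cu3 α
            _ = _ := by ring
        · calc _ ≤ eLpNorm u2 q volume *
                (ENNReal.ofReal (2 / |α|) * (ENNReal.ofReal (A * R) * eLpNorm u3 ⊤ volume)) := by
                gcongr
                · exact qb1 hq' hv2 cu2 α
                · exact (qb2 le_top cv3 α).trans (by gcongr)
            _ = _ := by ring
      calc _ ≤ eLpNorm (fun x => Q u1 x α) 2 volume *
            eLpNorm (fun x => Q v2 x α * Q v3 x α) q volume := by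
            exact holder_mul (Q_meas_x cu1 α) (by fun_prop)
        _ ≤ (ENNReal.ofReal (2 / |α|) * eLpNorm u1 2 volume) *
            (ENNReal.ofReal (2 / |α| * (A * R)) * (eLpNorm u2 q volume * eLpNorm u3 ⊤ volume)) := by
            gcongr
            exact qb2 (by norm_num) cu1 α
        _ = (ENNReal.ofReal (2 / |α|) * ENNReal.ofReal (2 / |α| * (A * R))) * T := by rw [hT]; ring
        _ ≤ _ := by
            rw [← ENNReal.ofReal_mul (by positivity), ← ENNReal.ofReal_mul (by positivity)]
            refine mul_le_mul_left (ENNReal.ofReal_le_ofReal ?_) _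
            have e1 : 2 / |α| * (2 / |α| * (A * R)) = 4 * A * R / α ^ 2 := by
              rw [← sq_abs α]; field_simp; ring
            have e2 : 8 * A / R * (1 + (α / R) ^ 2)⁻¹ = 8 * A * R / (R ^ 2 + α ^ 2) := by
              field_simp
            rw [e1, e2]
            have hsq : R ^ 2 ≤ α ^ 2 := by rw [← sq_abs α]; gcongr
            have hp2 : 0 < α ^ 2 := by rw [← sq_abs α]; positivity
            rw [div_le_div_iff₀ hp2 (by positivity)]
            have : 0 ≤ A * R := by positivity
            nlinarith
    · refine (setLIntegral_le_lintegral _ _).trans (le_of_eq ?_)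
      rw [lintegral_mul_const _ (by fun_prop), lintegral_const_mul _ (by fun_prop), poisson_int hR,
        ← ENNReal.ofReal_mul (by positivity)]
      congr 2
      field_simp
  rw [dec]
  have m2' := cu2.measurable
  have m3' := cu3.measurable
  have aW : AEStronglyMeasurable (fun x => W x * (u2 x * u3 x)) volume :=
    (by fun_prop : Measurable fun x => W x * (u2 x * u3 x)).aestronglyMeasurable
  refine (eLpNorm_add_le (aW.add smE.aestronglyMeasurable) smG.aestronglyMeasurable hp1).trans ?_
  refine (add_le_add (eLpNorm_add_le aW smE.aestronglyMeasurable hp1) le_rfl).trans ?_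
  refine (add_le_add (add_le_add B1 B2) B3).trans (le_of_eq ?_)
  rw [ENNReal.ofReal_add (by positivity) (by positivity)]
  ring

lemma mult_bound (θ : ℝ → ℂ) (hθ : ContDiff ℝ (⊤ : ℕ∞) θ) (hs : HasCompactSupport θ) :
    ∃ C : ℝ, 0 ≤ C ∧ ∀ (q : ℝ≥0∞) (_ : q = 1 ∨ q = 2 ∨ q = ⊤) (c : ℝ) (g : ℝ → ℂ), Integrable g →
      eLpNorm (𝓕⁻ (fun ξ => θ (c * ξ) * g ξ)) q volume ≤
        ENNReal.ofReal C * eLpNorm (𝓕⁻ g) q volume := by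
  set Θ := hs.toSchwartzMap hθ with hΘ
  set K : SchwartzMap ℝ ℂ := 𝓕⁻ Θ with hK
  have hKi : Integrable K := K.integrable
  have hKθ : ∀ y : ℝ, θ y = ∫ z : ℝ, Complex.exp (-(2 * π * z * y * I)) * K z := by
    intro y
    have : 𝓕 K = Θ := by rw [hK]; exact FourierTransform.fourier_fourierInv_eq Θ
    rw [← fourier_formula, ← SchwartzMap.fourier_coe, this]
    simp [hΘ]
  refine ⟨∫ y, ‖K y‖, by positivity, ?_⟩
  intro q hq c g hg
  have cg := inv_cont hg
  have e : (𝓕⁻ (fun ξ => θ (c * ξ) * g ξ) : ℝ → ℂ) = fun x => ∫ y, K y * 𝓕⁻ g (x - c * y) := by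
    ext x
    rw [inv_formula]
    have e1 : ∀ ξ : ℝ, Complex.exp (2 * π * ξ * x * I) * (θ (c * ξ) * g ξ) =
        ∫ y : ℝ, Complex.exp (2 * π * ξ * (x - c * y : ℝ) * I) * (K y * g ξ) := by
      intro ξ
      rw [hKθ, ← integral_mul_const, ← integral_const_mul]
      congr 1; ext y
      rw [← mul_assoc, ← mul_assoc, ← mul_assoc, ← Complex.exp_add]
      congr 3
      push_cast; ring
    simp only [e1]
    rw [integral_integral_swap]
    · congr 1; ext y
      rw [inv_formula, ← integral_const_mul]
      congr 1; ext ξ; ring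
    · have := hg.mul_prod hKi
      refine (this.norm).mono' ?_ ?_
      · apply AEStronglyMeasurable.mul
        · exact Continuous.aestronglyMeasurable (by fun_prop)
        · exact (this.aestronglyMeasurable).congr (Eventually.of_forall fun z => by simp [mul_comm])
      · refine Eventually.of_forall fun z => ?_
        simp only [Function.uncurry]
        rw [norm_mul, norm_e, one_mul, mul_comm (K z.2)]
  rw [e]
  refine (minkowski' (F := fun x y => K y * 𝓕⁻ g (x - c * y)) (N := fun y => ‖K y‖ₑ * eLpNorm (𝓕⁻ g) q volume)
    hq ?_ ?_ ?_).trans ?_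
  · have := K.continuous
    exact Continuous.measurable (by unfold Function.uncurry; fun_prop)
  · have := K.continuous.measurable
    fun_prop
  · refine Eventually.of_forall fun y => ?_
    have := eLpNorm_const_smul (K y) (fun x => 𝓕⁻ g (x - c * y)) q (volume : Measure ℝ)
    simp only [eLpNorm_shift cg] at this
    exact this.le
  · rw [lintegral_mul_const _ K.continuous.measurable.enorm]
    gcongr
    rw [ofReal_integral_norm_eq_lintegral_enorm hKi]

lemma sin_tail {a δ R : ℝ} (ha : 0 < a) (hδ : 0 < δ) (hδR : δ ≤ R) :
    |∫ α in δ..R, Real.sin (a * α) / α| ≤ 2 / (a * δ) := by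
  have hne : ∀ α ∈ uIcc δ R, α ≠ 0 := by
    intro α h
    rw [uIcc_of_le hδR] at h
    exact (hδ.trans_le h.1).ne'
  have hd : ∀ α ∈ uIcc δ R, HasDerivAt (fun α => -(Real.cos (a * α) / (a * α)))
      (Real.sin (a * α) / α + Real.cos (a * α) / (a * α ^ 2)) α := by
    intro α h
    have h0 := hne α h
    have hl : HasDerivAt (fun α : ℝ => a * α) a α := by simpa using (hasDerivAt_id α).const_mul a
    convert! ((hl.cos).div hl (by positivity)).neg using 1
    field_simp; ring
  have c1 : ContinuousOn (fun α => Real.sin (a * α) / α) (uIcc δ R) :=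
    ContinuousOn.div (by fun_prop) (by fun_prop) hne
  have c2 : ContinuousOn (fun α => Real.cos (a * α) / (a * α ^ 2)) (uIcc δ R) :=
    ContinuousOn.div (by fun_prop) (by fun_prop) (fun α h => by have := hne α h; positivity)
  have c3 : ContinuousOn (fun α => 1 / (a * α ^ 2)) (uIcc δ R) :=
    ContinuousOn.div (by fun_prop) (by fun_prop) (fun α h => by have := hne α h; positivity)
  have e1 := intervalIntegral.integral_eq_sub_of_hasDerivAt hd
    (c1.intervalIntegrable.add c2.intervalIntegrable)
  rw [intervalIntegral.integral_add c1.intervalIntegrable c2.intervalIntegrable] at e1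
  have hd3 : ∀ α ∈ uIcc δ R, HasDerivAt (fun α => -(1 / (a * α))) (1 / (a * α ^ 2)) α := by
    intro α h
    have h0 := hne α h
    have hl : HasDerivAt (fun α : ℝ => a * α) a α := by simpa using (hasDerivAt_id α).const_mul a
    convert! ((hasDerivAt_const α (1:ℝ)).div hl (by positivity)).neg using 1
    field_simp; ring
  have e3 := intervalIntegral.integral_eq_sub_of_hasDerivAt hd3 c3.intervalIntegrable
  have b2 : |∫ α in δ..R, Real.cos (a * α) / (a * α ^ 2)| ≤ ∫ α in δ..R, 1 / (a * α ^ 2) := by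
    refine (intervalIntegral.abs_integral_le_integral_abs hδR).trans ?_
    refine intervalIntegral.integral_mono_on hδR c2.abs.intervalIntegrable c3.intervalIntegrable ?_
    intro α _
    rw [abs_div, abs_of_nonneg (show 0 ≤ a * α ^ 2 by positivity)]
    gcongr
    exact Real.abs_cos_le_one _
  have hR := hδ.trans_le hδR
  have b3 : |Real.cos (a * R) / (a * R)| ≤ 1 / (a * R) := by
    rw [abs_div, abs_of_nonneg (show 0 ≤ a * R by positivity)]
    gcongr
    exact Real.abs_cos_le_one _
  have b4 : |Real.cos (a * δ) / (a * δ)| ≤ 1 / (a * δ) := by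
    rw [abs_div, abs_of_nonneg (show 0 ≤ a * δ by positivity)]
    gcongr
    exact Real.abs_cos_le_one _
  rw [e3] at b2
  have : 2 / (a * δ) = 1 / (a * δ) + 1 / (a * δ) := by ring
  rw [this]
  rw [abs_le] at *
  constructor <;> linarith [b2.1, b2.2, b3.1, b3.2, b4.1, b4.2]

lemma sin_ii (a : ℝ) (x y : ℝ) : IntervalIntegrable (fun α => Real.sin (a * α) / α) volume x y := by
  rw [intervalIntegrable_iff]
  refine Measure.integrableOn_of_bounded (M := |a|) (by simp [uIoc]) (Measurable.aestronglyMeasurable (by fun_prop)) ?_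
  refine Eventually.of_forall fun α => ?_
  rw [norm_div, Real.norm_eq_abs, Real.norm_eq_abs]
  refine div_le_of_le_mul₀ (abs_nonneg _) (abs_nonneg _) ?_
  rw [← abs_mul]
  exact Real.abs_sin_le_abs

lemma sin_small {a δ : ℝ} (hδ : 0 ≤ δ) :
    |∫ α in (0:ℝ)..δ, Real.sin (a * α) / α| ≤ |a| * δ := by
  have := intervalIntegral.norm_integral_le_of_norm_le_const (a := 0) (b := δ) (C := |a|)
    (f := fun α => Real.sin (a * α) / α) (fun α _ => by
      rw [norm_div, Real.norm_eq_abs, Real.norm_eq_abs]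
      refine div_le_of_le_mul₀ (abs_nonneg _) (abs_nonneg _) ?_
      rw [← abs_mul]
      exact Real.abs_sin_le_abs)
  simpa [abs_of_nonneg hδ] using this

lemma sin_pos {a R : ℝ} (ha : 0 < a) (hR : 0 < R) :
    |∫ α in (0:ℝ)..R, Real.sin (a * α) / α| ≤ 3 := by
  rcases le_total R a⁻¹ with h | h
  · refine (sin_small hR.le).trans ?_
    rw [abs_of_pos ha]
    calc a * R ≤ a * a⁻¹ := by gcongr
      _ = 1 := mul_inv_cancel₀ ha.ne'
      _ ≤ 3 := by norm_num
  · rw [← intervalIntegral.integral_add_adjacent_intervals (sin_ii a 0 a⁻¹) (sin_ii a a⁻¹ R)]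
    have h1 := sin_small (a := a) (δ := a⁻¹) (by positivity)
    have h2 := sin_tail ha (by positivity) h
    rw [abs_of_pos ha, mul_inv_cancel₀ ha.ne'] at h1
    rw [mul_inv_cancel₀ ha.ne'] at h2
    refine (abs_add_le _ _).trans ?_
    linarith

lemma sin_all (a : ℝ) {R : ℝ} (hR : 0 < R) :
    |∫ α in (0:ℝ)..R, Real.sin (a * α) / α| ≤ 3 := by
  rcases lt_trichotomy a 0 with h | h | h
  · have := sin_pos (neg_pos.2 h) hR
    simp only [neg_mul, Real.sin_neg, neg_div, intervalIntegral.integral_neg, abs_neg] at this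
    exact this
  · simp [h]
  · exact sin_pos h hR

/-- symbol of the truncated Hilbert transform -/
def msym (R ξ : ℝ) : ℂ := ∫ α in Ioc (-R) R, (α:ℂ)⁻¹ * (1 - Complex.exp (-(2 * π * α * ξ * I)))

lemma ker_bound (α ξ : ℝ) : ‖(α:ℂ)⁻¹ * (1 - Complex.exp (-(2 * π * α * ξ * I)))‖ ≤ 2 * π * |ξ| := by
  have h := Real.norm_exp_I_mul_ofReal_sub_one_le (x := -(2 * π * α * ξ))
  have e : I * ((-(2 * π * α * ξ) : ℝ) : ℂ) = -(2 * π * α * ξ * I) := by push_cast; ring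
  rw [e] at h
  rw [norm_mul, norm_inv, Complex.norm_real, norm_sub_rev]
  have h' : ‖(-(2 * π * α * ξ) : ℝ)‖ = |α| * (2 * π * |ξ|) := by
    rw [Real.norm_eq_abs, abs_neg, abs_mul, abs_mul, abs_of_pos (show 0 < 2 * π by positivity)]; ring
  rw [h'] at h
  calc _ ≤ ‖α‖⁻¹ * (|α| * (2 * π * |ξ|)) := by gcongr
    _ = (|α|⁻¹ * |α|) * (2 * π * |ξ|) := by rw [Real.norm_eq_abs]; ring
    _ ≤ _ := mul_le_of_le_one_left (by positivity) inv_mul_le_one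

lemma msym_le {R : ℝ} (hR : 0 < R) (ξ : ℝ) : ‖msym R ξ‖ ≤ 6 := by
  have ii : ∀ x y : ℝ, IntervalIntegrable
      (fun α : ℝ => (α:ℂ)⁻¹ * (1 - Complex.exp (-(2 * π * α * ξ * I)))) volume x y := by
    intro x y
    rw [intervalIntegrable_iff]
    refine Measure.integrableOn_of_bounded (M := 2 * π * |ξ|) (by simp [uIoc]) (by fun_prop) ?_
    exact Eventually.of_forall fun α => ker_bound α ξ
  have e : msym R ξ = ∫ α in (0:ℝ)..R, (2 * I) * ((Real.sin (2 * π * ξ * α) / α : ℝ) : ℂ) := by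
    rw [msym, ← intervalIntegral.integral_of_le (by linarith),
      ← intervalIntegral.integral_add_adjacent_intervals (ii (-R) 0) (ii 0 R)]
    have := intervalIntegral.integral_comp_neg (a := 0) (b := R)
      (fun α : ℝ => (α:ℂ)⁻¹ * (1 - Complex.exp (-(2 * π * α * ξ * I))))
    rw [neg_zero] at this
    rw [← this, ← intervalIntegral.integral_add]
    · apply intervalIntegral.integral_congr
      intro α _
      simp only
      push_cast
      rw [Complex.sin]
      have : (2 * π * ξ * α * I : ℂ) = 2 * π * α * ξ * I := by ring
      rw [show -(2 * π * ξ * α : ℂ) * I = -(2 * π * α * ξ * I) by ring, this,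
        show -(2 * π * (-α) * ξ * I : ℂ) = 2 * π * α * ξ * I by ring, inv_neg, div_eq_mul_inv]
      linear_combination (-(Complex.exp (-(2 * π * α * ξ * I)) - Complex.exp (2 * π * α * ξ * I)) * (α:ℂ)⁻¹) * Complex.I_sq
    · rw [intervalIntegrable_iff]
      refine Measure.integrableOn_of_bounded (M := 2 * π * |ξ|) (by simp [uIoc]) (Measurable.aestronglyMeasurable (by fun_prop)) ?_
      exact Eventually.of_forall fun α => ker_bound (-α) ξ
    · exact ii _ _
  rw [e, intervalIntegral.integral_const_mul, intervalIntegral.integral_ofReal, norm_mul,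
    Complex.norm_real, Real.norm_eq_abs]
  have := sin_all (2 * π * ξ) hR
  simp
  linarith

lemma hilbert_bound {g : ℝ → ℂ} (hg : Integrable g) (hg2 : MemLp g 2 volume)
    (hg1 : Integrable (fun ξ : ℝ => (ξ : ℂ) * g ξ)) {R : ℝ} (hR : 0 < R) :
    eLpNorm (fun x => ∫ α in Ioc (-R) R, Q (𝓕⁻ g) x α) 2 volume ≤
      ENNReal.ofReal 6 * eLpNorm (𝓕⁻ g) 2 volume := by
  have mk : StronglyMeasurable (fun z : ℝ × ℝ => (z.2:ℂ)⁻¹ * (1 - Complex.exp (-(2 * π * z.2 * z.1 * I)))) :=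
    Measurable.stronglyMeasurable (by fun_prop)
  have mm : StronglyMeasurable (msym R) := mk.integral_prod_right' (ν := volume.restrict (Ioc (-R) R))
  have e : (fun x => ∫ α in Ioc (-R) R, Q (𝓕⁻ g) x α) = 𝓕⁻ (fun ξ => msym R ξ * g ξ) := by
    ext x
    rw [inv_formula]
    have e1 : ∀ α : ℝ, Q (𝓕⁻ g) x α = ∫ ξ : ℝ, Complex.exp (2 * π * ξ * x * I) *
        (((α:ℂ)⁻¹ * (1 - Complex.exp (-(2 * π * α * ξ * I)))) * g ξ) := by
      intro α
      have ie : ∀ y : ℝ, Integrable (fun ξ : ℝ => Complex.exp (2 * π * ξ * y * I) * g ξ) := by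
        intro y
        refine hg.norm.mono' (AEStronglyMeasurable.mul (Continuous.aestronglyMeasurable (by fun_prop)) hg.1) ?_
        exact Eventually.of_forall fun ξ => by rw [norm_mul, norm_e, one_mul]
      rw [Q, inv_formula, inv_formula, ← integral_sub (ie _) (ie _), ← integral_const_mul]
      congr 1; ext ξ
      have : Complex.exp (2 * π * ξ * (x - α : ℝ) * I) =
          Complex.exp (2 * π * ξ * x * I) * Complex.exp (-(2 * π * α * ξ * I)) := by
        rw [← Complex.exp_add]; congr 1; push_cast; ring
      rw [this]; ring
    simp only [e1]
    rw [integral_integral_swap]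
    · congr 1; ext ξ
      rw [integral_const_mul, integral_mul_const]; rfl
    · have c1 : Integrable (fun _ : ℝ => (2 * π : ℂ)) (volume.restrict (Ioc (-R) R)) := integrable_const _
      have := c1.mul_prod hg1
      refine this.norm.mono' ?_ ?_
      · apply AEStronglyMeasurable.mul
        · exact Continuous.aestronglyMeasurable (by fun_prop)
        · apply AEStronglyMeasurable.mul
          · exact Measurable.aestronglyMeasurable (by fun_prop)
          · exact hg.1.comp_snd
      · refine Eventually.of_forall fun z => ?_
        simp only [Function.uncurry]
        rw [norm_mul, norm_e, one_mul, norm_mul, norm_mul (2 * π : ℂ), norm_mul (z.2 : ℂ), ← mul_assoc]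
        gcongr
        refine (ker_bound z.1 z.2).trans (le_of_eq ?_)
        simp [abs_of_pos Real.pi_pos]
  have bd : ∀ ξ, ‖msym R ξ * g ξ‖ ≤ 6 * ‖g ξ‖ := fun ξ => by
    rw [norm_mul]; gcongr; exact msym_le hR ξ
  have am : AEStronglyMeasurable (fun ξ => msym R ξ * g ξ) volume := mm.aestronglyMeasurable.mul hg.1
  have i1 : Integrable (fun ξ => msym R ξ * g ξ) :=
    (hg.norm.const_mul 6).mono' am (Eventually.of_forall bd)
  have i2 : MemLp (fun ξ => msym R ξ * g ξ) 2 volume :=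
    hg2.of_le_mul am (Eventually.of_forall bd)
  rw [e, plancherelInv _ i1 i2, plancherelInv _ hg hg2]
  exact eLpNorm_le_mul_eLpNorm_of_ae_le_mul (Eventually.of_forall bd) 2

lemma inv_const_mul (c : ℂ) (g : ℝ → ℂ) : 𝓕⁻ (fun ξ => c * g ξ) = c • 𝓕⁻ g := by
  ext x
  rw [Pi.smul_apply, inv_formula, inv_formula, smul_eq_mul, ← integral_const_mul]
  congr 1; ext ξ; ring

lemma two_zpow_supp {k : ℤ} {ξ : ℝ} (h : |(2:ℝ) ^ (-k) * ξ| ∈ Icc (1/2 : ℝ) 2) :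
    (2:ℝ) ^ k / 2 ≤ |ξ| ∧ |ξ| ≤ 2 * (2:ℝ) ^ k := by
  have hk : (0:ℝ) < 2 ^ k := by positivity
  rw [abs_mul, abs_of_pos (by positivity), zpow_neg] at h
  obtain ⟨h1, h2⟩ := h
  rw [inv_mul_eq_div] at h1 h2
  rw [le_div_iff₀ hk] at h1
  rw [div_le_iff₀ hk] at h2
  constructor <;> linarith

lemma bern : ∃ A : ℝ, 0 ≤ A ∧ ∀ (q : ℝ≥0∞) (_ : q = 1 ∨ q = 2 ∨ q = ⊤) (k : ℤ) (g : ℝ → ℂ),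
    Integrable g → (∀ ξ, g ξ ≠ 0 → |(2:ℝ) ^ (-k) * ξ| ∈ Icc (1/2 : ℝ) 2) →
    eLpNorm (𝓕⁻ (fun ξ : ℝ => (2 * π * I * ξ) * g ξ)) q volume ≤
      ENNReal.ofReal (A * 2 ^ k) * eLpNorm (𝓕⁻ g) q volume ∧
    eLpNorm (𝓕⁻ (fun ξ : ℝ => (2 * π * I * ξ)⁻¹ * g ξ)) q volume ≤
      ENNReal.ofReal (A * (2 ^ k)⁻¹) * eLpNorm (𝓕⁻ g) q volume := by
  let s : ℝ → ℝ := fun ξ => Real.smoothTransition ((16 - ξ ^ 2) / 12)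
  let D : ℝ → ℝ := fun ξ => ξ ^ 2 + 1 - Real.smoothTransition ((16 * ξ ^ 2 - 1) / 3)
  have hs : ContDiff ℝ (⊤ : ℕ∞) s := Real.smoothTransition.contDiff.comp (by fun_prop)
  have hD : ContDiff ℝ (⊤ : ℕ∞) D := by
    have : ContDiff ℝ (⊤ : ℕ∞) (fun ξ : ℝ => Real.smoothTransition ((16 * ξ ^ 2 - 1) / 3)) :=
      Real.smoothTransition.contDiff.comp (by fun_prop)
    have h2 : ContDiff ℝ (⊤ : ℕ∞) (fun ξ : ℝ => ξ ^ 2 + 1) := by fun_prop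
    exact h2.sub this
  have hD0 : ∀ ξ, D ξ ≠ 0 := by
    intro ξ
    by_cases h : ξ = 0
    · simp only [D, h]
      rw [Real.smoothTransition.zero_of_nonpos (by norm_num)]; norm_num
    · have := Real.smoothTransition.le_one ((16 * ξ ^ 2 - 1) / 3)
      have : 0 < ξ ^ 2 := by positivity
      simp only [D]
      linarith
  have s1 : ∀ ξ : ℝ, |ξ| ≤ 2 → s ξ = 1 := by
    intro ξ h
    apply Real.smoothTransition.one_of_one_le
    have := sq_le_sq' (by linarith [abs_nonneg ξ]) h
    rw [sq_abs] at this
    linarith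
  have D1 : ∀ ξ : ℝ, 1/2 ≤ |ξ| → D ξ = ξ ^ 2 := by
    intro ξ h
    have := pow_le_pow_left₀ (by norm_num) h 2
    rw [sq_abs] at this
    simp only [D]
    rw [Real.smoothTransition.one_of_one_le (by linarith)]
    ring
  have ss : HasCompactSupport s := by
    refine HasCompactSupport.intro (isCompact_Icc (a := (-4:ℝ)) (b := 4)) ?_
    intro ξ h
    apply Real.smoothTransition.zero_of_nonpos
    have : 4 < |ξ| := by
      by_contra! h'
      exact h (abs_le.1 h')
    have := pow_le_pow_left₀ (by norm_num) this.le 2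
    rw [sq_abs] at this
    linarith
  have sc : HasCompactSupport (fun ξ => (s ξ : ℂ)) := ss.comp_left (g := fun r : ℝ => (r : ℂ)) (by simp)
  have cs : ContDiff ℝ (⊤ : ℕ∞) (fun ξ => (s ξ : ℂ)) := Complex.ofRealCLM.contDiff.comp hs
  have cx : ContDiff ℝ (⊤ : ℕ∞) (fun ξ : ℝ => (ξ : ℂ)) := Complex.ofRealCLM.contDiff
  have cD : ContDiff ℝ (⊤ : ℕ∞) (fun ξ => ((ξ / D ξ : ℝ) : ℂ)) :=
    Complex.ofRealCLM.contDiff.comp (contDiff_id.div hD hD0)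
  obtain ⟨A1, hA1, H1⟩ := mult_bound (fun ξ => (s ξ : ℂ) * (2 * π * I * ξ))
    (cs.mul (contDiff_const.mul cx)) sc.mul_right
  obtain ⟨A2, hA2, H2⟩ := mult_bound (fun ξ => (s ξ : ℂ) * ((2 * π * I)⁻¹ * ((ξ / D ξ : ℝ) : ℂ)))
    (cs.mul (contDiff_const.mul cD)) sc.mul_right
  refine ⟨max A1 A2, le_max_of_le_left hA1, ?_⟩
  intro q hq k g hg hsupp
  have hk : (0:ℝ) < 2 ^ k := by positivity
  have hkc : ((2:ℂ) ^ k) ≠ 0 := zpow_ne_zero k two_ne_zero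
  constructor
  · have e : (fun ξ : ℝ => (2 * π * I * ξ) * g ξ) = fun ξ : ℝ => ((2 ^ k : ℝ) : ℂ) *
        ((s ((2:ℝ) ^ (-k) * ξ) : ℂ) * (2 * π * I * ((2:ℝ) ^ (-k) * ξ : ℝ)) * g ξ) := by
      ext ξ
      by_cases h : g ξ = 0
      · simp [h]
      · rw [s1 _ (hsupp ξ h).2]
        push_cast
        rw [zpow_neg]
        field_simp
    rw [e, inv_const_mul, eLpNorm_const_smul]
    calc _ ≤ ENNReal.ofReal (2 ^ k) * (ENNReal.ofReal A1 * eLpNorm (𝓕⁻ g) q volume) := by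
          gcongr
          · rw [← ofReal_norm, Complex.norm_real, Real.norm_of_nonneg hk.le]
          · exact H1 q hq _ g hg
      _ ≤ _ := by
          rw [← mul_assoc, ← ENNReal.ofReal_mul hk.le, mul_comm (2 ^ k : ℝ)]
          gcongr
          exact le_max_left _ _
  · have e : (fun ξ : ℝ => (2 * π * I * ξ)⁻¹ * g ξ) = fun ξ : ℝ => (((2 ^ k)⁻¹ : ℝ) : ℂ) *
        ((s ((2:ℝ) ^ (-k) * ξ) : ℂ) * ((2 * π * I)⁻¹ *
          ((((2:ℝ) ^ (-k) * ξ) / D ((2:ℝ) ^ (-k) * ξ) : ℝ) : ℂ)) * g ξ) := by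
      ext ξ
      by_cases h : g ξ = 0
      · simp [h]
      · rw [s1 _ (hsupp ξ h).2, D1 _ (hsupp ξ h).1]
        have h0 : ξ ≠ 0 := by
          rintro rfl
          have := (hsupp 0 h).1
          norm_num at this
        have h0' : (ξ : ℂ) ≠ 0 := by exact_mod_cast h0
        push_cast
        rw [zpow_neg]
        field_simp
    rw [e, inv_const_mul, eLpNorm_const_smul]
    calc _ ≤ ENNReal.ofReal ((2 ^ k)⁻¹) * (ENNReal.ofReal A2 * eLpNorm (𝓕⁻ g) q volume) := by
          gcongr
          · rw [← ofReal_norm, Complex.norm_real, Real.norm_of_nonneg (by positivity)]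
          · exact H2 q hq _ g hg
      _ ≤ _ := by
          rw [← mul_assoc, ← ENNReal.ofReal_mul (by positivity), mul_comm ((2 ^ k)⁻¹ : ℝ)]
          gcongr
          exact le_max_right _ _

/-- package of properties of a frequency localized function -/
structure Good (A : ℝ) (k : ℤ) (g v u u' u'' : ℝ → ℂ) (M : ℝ) : Prop where
  eq : u = 𝓕⁻ g
  ig : Integrable g
  mg : MemLp g 2 volume
  ig1 : Integrable (fun ξ : ℝ => (ξ : ℂ) * g ξ)
  dv : ∀ x, HasDerivAt v (u x) x
  du : ∀ x, HasDerivAt u (u' x) x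
  du' : ∀ x, HasDerivAt u' (u'' x) x
  bv : ∀ x, ‖v x‖ ≤ M
  bu : ∀ x, ‖u x‖ ≤ M
  bu' : ∀ x, ‖u' x‖ ≤ M
  bu'' : ∀ x, ‖u'' x‖ ≤ M
  n1 : ∀ (q : ℝ≥0∞) (_ : q = 1 ∨ q = 2 ∨ q = ⊤),
    eLpNorm u' q volume ≤ ENNReal.ofReal (A * 2 ^ k) * eLpNorm u q volume
  n0 : ∀ (q : ℝ≥0∞) (_ : q = 1 ∨ q = 2 ∨ q = ⊤),
    eLpNorm v q volume ≤ ENNReal.ofReal (A * (2 ^ k)⁻¹) * eLpNorm u q volume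

lemma Good.mono {A : ℝ} {k : ℤ} {g v u u' u'' : ℝ → ℂ} {M M' : ℝ} (h : Good A k g v u u' u'' M)
    (hM : M ≤ M') : Good A k g v u u' u'' M' :=
  { h with
    bv := fun x => (h.bv x).trans hM
    bu := fun x => (h.bu x).trans hM
    bu' := fun x => (h.bu' x).trans hM
    bu'' := fun x => (h.bu'' x).trans hM }

lemma phi_cont {φ₀ : ℝ → ℝ} (hφ : IsLPBump φ₀) (k : ℤ) : Continuous (phi φ₀ k) :=
  hφ.1.continuous.comp (by fun_prop)

lemma phi_supp {φ₀ : ℝ → ℝ} (hφ : IsLPBump φ₀) (k : ℤ) (ξ : ℝ) (h : phi φ₀ k ξ ≠ 0) :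
    |(2:ℝ) ^ (-k) * ξ| ∈ Icc (1/2 : ℝ) 2 := hφ.2.2.2.1 _ h

lemma fourier_cont' (f : ℝ → ℂ) : Continuous (𝓕 f) := by
  by_cases h : Integrable f
  · exact fourier_cont h
  · have : (𝓕 f) = fun _ => 0 := by
      ext ξ
      rw [fourier_formula]
      apply integral_undef
      intro h'
      apply h
      have c : Continuous fun x : ℝ => Complex.exp (2 * π * x * ξ * I) := by fun_prop
      refine (integrable_norm_iff ?_).1 ?_
      · have := (c.aestronglyMeasurable (μ := volume)).mul h'.1
        refine this.congr (Eventually.of_forall fun x => ?_)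
        simp only [Pi.mul_apply]
        rw [← mul_assoc, ← Complex.exp_add]; simp
      · refine h'.norm.congr (Eventually.of_forall fun x => ?_)
        simp only
        rw [norm_mul, Complex.exp_neg, norm_inv, norm_e]; simp
    rw [this]; exact continuous_const

lemma good_exists {φ₀ : ℝ → ℝ} (hφ : IsLPBump φ₀) : ∃ A : ℝ, 0 ≤ A ∧ ∀ (k : ℤ) (f : ℝ → ℂ),
    ∃ g v u' u'' M, Good A k g v (P φ₀ k f) u' u'' M := by
  obtain ⟨A, hA, H⟩ := bern
  refine ⟨A, hA, fun k f => ?_⟩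
  set g : ℝ → ℂ := fun ξ => (phi φ₀ k ξ : ℂ) * 𝓕 f ξ with hg
  have hsupp : ∀ ξ, g ξ ≠ 0 → |(2:ℝ) ^ (-k) * ξ| ∈ Icc (1/2 : ℝ) 2 := by
    intro ξ h
    apply phi_supp hφ
    intro h0
    apply h
    simp [hg, h0]
  have cg : Continuous g :=
    (Complex.continuous_ofReal.comp (phi_cont hφ k)).mul (fourier_cont' f)
  have sg : HasCompactSupport g := by
    refine HasCompactSupport.intro (isCompact_Icc (a := -(2 * (2:ℝ) ^ k)) (b := 2 * (2:ℝ) ^ k)) ?_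
    intro ξ h
    by_contra h'
    exact h (abs_le.1 (two_zpow_supp (hsupp ξ h')).2)
  have ig : Integrable g := cg.integrable_of_hasCompactSupport sg
  have mg : MemLp g 2 volume := cg.memLp_of_hasCompactSupport sg
  have i1 : Integrable (fun ξ : ℝ => (ξ : ℂ) * g ξ) :=
    (show Continuous (fun ξ : ℝ => (ξ : ℂ) * g ξ) by fun_prop).integrable_of_hasCompactSupport sg.mul_left
  have i2 : Integrable (fun ξ : ℝ => (2 * π * I * ξ) * g ξ) :=
    (show Continuous (fun ξ : ℝ => (2 * π * I * ξ : ℂ) * g ξ) by fun_prop).integrable_of_hasCompactSupport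
      sg.mul_left
  have i3 : Integrable (fun ξ : ℝ => (2 * π * I * ξ) * ((2 * π * I * ξ) * g ξ)) :=
    (show Continuous (fun ξ : ℝ => (2 * π * I * ξ : ℂ) * ((2 * π * I * ξ) * g ξ)) by fun_prop).integrable_of_hasCompactSupport
      sg.mul_left.mul_left
  have hne : ∀ ξ : ℝ, g ξ ≠ 0 → (2 * π * I * ξ : ℂ) ≠ 0 := by
    intro ξ h
    have := (two_zpow_supp (hsupp ξ h)).1
    have h0 : ξ ≠ 0 := by
      rintro rfl
      have h2 : (0:ℝ) < 2 ^ k := by positivity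
      simp at this
      linarith
    simp [h0, Real.pi_ne_zero]
  have e0 : (fun ξ : ℝ => (2 * π * I * ξ) * ((2 * π * I * ξ)⁻¹ * g ξ)) = g := by
    ext ξ
    by_cases h : g ξ = 0
    · simp [h]
    · rw [mul_inv_cancel_left₀ (hne ξ h)]
  have i0 : Integrable (fun ξ : ℝ => (2 * π * I * ξ : ℂ)⁻¹ * g ξ) := by
    refine (ig.norm.const_mul ((2 * π * ((2:ℝ) ^ k / 2))⁻¹)).mono'
      ((Measurable.aestronglyMeasurable (by fun_prop)).mul ig.1) (Eventually.of_forall fun ξ => ?_)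
    by_cases h : g ξ = 0
    · simp [h]
    · rw [norm_mul]
      gcongr
      rw [norm_inv]
      have h2 : (0:ℝ) < 2 ^ k := by positivity
      apply inv_anti₀ (by positivity)
      have := (two_zpow_supp (hsupp ξ h)).1
      simp [abs_of_pos Real.pi_pos]
      gcongr
  obtain ⟨M0, b0⟩ : ∃ M, ∀ x, ‖𝓕⁻ (fun ξ : ℝ => (2 * π * I * ξ : ℂ)⁻¹ * g ξ) x‖ ≤ M := ⟨_, inv_bdd _⟩
  obtain ⟨M1, b1⟩ : ∃ M, ∀ x, ‖𝓕⁻ g x‖ ≤ M := ⟨_, inv_bdd _⟩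
  obtain ⟨M2, b2⟩ : ∃ M, ∀ x, ‖𝓕⁻ (fun ξ : ℝ => (2 * π * I * ξ : ℂ) * g ξ) x‖ ≤ M := ⟨_, inv_bdd _⟩
  obtain ⟨M3, b3⟩ : ∃ M, ∀ x, ‖𝓕⁻ (fun ξ : ℝ => (2 * π * I * ξ : ℂ) * ((2 * π * I * ξ) * g ξ)) x‖ ≤ M :=
    ⟨_, inv_bdd _⟩
  have eu : P φ₀ k f = 𝓕⁻ g := rfl
  refine ⟨g, 𝓕⁻ (fun ξ : ℝ => (2 * π * I * ξ : ℂ)⁻¹ * g ξ), 𝓕⁻ (fun ξ : ℝ => (2 * π * I * ξ : ℂ) * g ξ),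
    𝓕⁻ (fun ξ : ℝ => (2 * π * I * ξ : ℂ) * ((2 * π * I * ξ) * g ξ)), max (max M0 M1) (max M2 M3), ?_⟩
  rw [eu]
  exact
  { eq := rfl
    ig := ig
    mg := mg
    ig1 := i1
    dv := fun x => by
      have := inv_deriv i0 (by rw [e0]; exact ig) x
      rwa [e0] at this
    du := fun x => inv_deriv ig i2 x
    du' := fun x => inv_deriv i2 i3 x
    bv := fun x => (b0 x).trans (by simp)
    bu := fun x => (b1 x).trans (by simp)
    bu' := fun x => (b2 x).trans (by simp)
    bu'' := fun x => (b3 x).trans (by simp)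
    n1 := fun q hq => (H q hq k g ig hsupp).1
    n0 := fun q hq => (H q hq k g ig hsupp).2 }

lemma fourier_undef {f : ℝ → ℂ} (h : ¬ Integrable f) (ξ : ℝ) : 𝓕 f ξ = 0 := by
  rw [fourier_formula]
  apply integral_undef
  intro h'
  apply h
  have c : Continuous fun x : ℝ => Complex.exp (2 * π * x * ξ * I) := by fun_prop
  refine (integrable_norm_iff ?_).1 ?_
  · have := (c.aestronglyMeasurable (μ := volume)).mul h'.1
    refine this.congr (Eventually.of_forall fun x => ?_)
    simp only [Pi.mul_apply]
    rw [← mul_assoc, ← Complex.exp_add]; simp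
  · refine h'.norm.congr (Eventually.of_forall fun x => ?_)
    simp only
    rw [norm_mul, Complex.exp_neg, norm_inv, norm_e]; simp

lemma fourier_norm_le (h : ℝ → ℂ) (ξ : ℝ) : ‖𝓕 h ξ‖ ≤ ∫ x, ‖h x‖ := by
  rw [fourier_formula]
  refine (norm_integral_le_integral_norm _).trans (le_of_eq ?_)
  congr 1; ext x
  rw [norm_mul, Complex.exp_neg, norm_inv, norm_e]; simp

lemma cont_of_deriv {u u' : ℝ → ℂ} (h : ∀ x, HasDerivAt u (u' x) x) : Continuous u :=
  continuous_iff_continuousAt.2 fun x => (h x).continuousAt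

lemma fstar_eq {v u : ℝ → ℂ} (h : ∀ x, HasDerivAt v (u x) x) (hu : Continuous u) (x α : ℝ) :
    fstar u x α = Q v x α := by
  rw [fstar, Q, intervalIntegral.integral_eq_sub_of_hasDerivAt (fun y _ => h y) (hu.intervalIntegrable _ _)]

lemma Q_deriv {v u : ℝ → ℂ} (h : ∀ x, HasDerivAt v (u x) x) (x α : ℝ) :
    HasDerivAt (fun z => Q v z α) (Q u x α) x := by
  unfold Q
  exact ((h x).sub ((h (x - α)).comp_sub_const x α)).const_mul _

/-- the undifferentiated trilinear integral -/
def TI (u1 v2 v3 : ℝ → ℂ) (x : ℝ) : ℂ := ∫ α, Q u1 x α * Q v2 x α * Q v3 x α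

lemma TI_diff {A M : ℝ} {k1 k2 k3 : ℤ} {g1 v1 u1 u1' u1'' g2 v2 u2 u2' u2'' g3 v3 u3 u3' u3'' : ℝ → ℂ}
    (h1 : Good A k1 g1 v1 u1 u1' u1'' M) (h2 : Good A k2 g2 v2 u2 u2' u2'' M)
    (h3 : Good A k3 g3 v3 u3 u3' u3'' M) : Differentiable ℝ (TI u1 v2 v3) := by
  intro x
  have c1 := cont_of_deriv h1.du
  have c1' := cont_of_deriv h1.du'
  have c2 := cont_of_deriv h2.du
  have c3 := cont_of_deriv h3.du
  have d2 := cont_of_deriv h2.dv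
  have d3 := cont_of_deriv h3.dv
  have key := hasDerivAt_integral_of_dominated_loc_of_deriv_le (μ := volume) (s := univ) (x₀ := x)
    (bound := fun α : ℝ => 3 * (5 * M ^ 3) * (1 + α ^ 2)⁻¹)
    (F := fun x α => Q u1 x α * Q v2 x α * Q v3 x α)
    (F' := fun x α => (Q u1' x α * Q v2 x α + Q u1 x α * Q u2 x α) * Q v3 x α
      + (Q u1 x α * Q v2 x α) * Q u3 x α) univ_mem ?_ ?_ ?_ ?_ ?_ ?_
  · exact key.2.differentiableAt
  · refine Eventually.of_forall fun z => ?_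
    exact (((Q_meas_a c1 z).mul (Q_meas_a d2 z)).mul (Q_meas_a d3 z)).aestronglyMeasurable
  · refine (integrable_inv_one_add_sq.const_mul (5 * M ^ 3)).mono'
      (((Q_meas_a c1 x).mul (Q_meas_a d2 x)).mul (Q_meas_a d3 x)).aestronglyMeasurable ?_
    refine Eventually.of_forall fun α => ?_
    exact Q_prod h2.dv h2.bu h2.bv h3.dv h3.bu h3.bv x α _ (Q_le h1.du h1.bu' x α)
  · exact (((((Q_meas_a c1' x).mul (Q_meas_a d2 x)).add ((Q_meas_a c1 x).mul (Q_meas_a c2 x))).mul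
      (Q_meas_a d3 x)).add (((Q_meas_a c1 x).mul (Q_meas_a d2 x)).mul (Q_meas_a c3 x))).aestronglyMeasurable
  · refine Eventually.of_forall fun α z _ => ?_
    have e1 := Q_prod h2.dv h2.bu h2.bv h3.dv h3.bu h3.bv z α _ (Q_le h1.du' h1.bu'' z α)
    have e2 := Q_prod h2.du h2.bu' h2.bu h3.dv h3.bu h3.bv z α _ (Q_le h1.du h1.bu' z α)
    have e3 := Q_prod h2.dv h2.bu h2.bv h3.du h3.bu' h3.bu z α _ (Q_le h1.du h1.bu' z α)
    rw [add_mul]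
    refine (norm_add₃_le).trans ?_
    linarith
  · exact integrable_inv_one_add_sq.const_mul _
  · refine Eventually.of_forall fun α z _ => ?_
    exact ((Q_deriv h1.du z α).mul (Q_deriv h2.dv z α)).mul (Q_deriv h3.dv z α)

lemma T3_eq {A M : ℝ} {k1 k2 k3 : ℤ} {g1 v1 u1 u1' u1'' g2 v2 u2 u2' u2'' g3 v3 u3 u3' u3'' : ℝ → ℂ}
    (h1 : Good A k1 g1 v1 u1 u1' u1'' M) (h2 : Good A k2 g2 v2 u2 u2' u2'' M)
    (h3 : Good A k3 g3 v3 u3 u3' u3'' M) :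
    T3 u1 u2 u3 = fun x => -(1/Real.pi : ℂ) * deriv (TI u1 v2 v3) x := by
  have c1 := cont_of_deriv h1.du
  have c2 := cont_of_deriv h2.du
  have c3 := cont_of_deriv h3.du
  unfold T3 TI
  simp only [fstar_eq h1.dv c1, fstar_eq h2.dv c2, fstar_eq h3.dv c3, (Q_deriv h1.dv _ _).deriv]

lemma last_step {φ₀ : ℝ → ℝ} (hφ : IsLPBump φ₀) (k : ℤ) {F : ℝ → ℂ} (dF : Differentiable ℝ F)
    (iF : Integrable F) (mF : MemLp F 2 volume) :
    eLpNorm (P φ₀ k (fun x => -(1/Real.pi : ℂ) * deriv F x)) 2 volume ≤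
      ENNReal.ofReal (4 * 2 ^ k) * eLpNorm F 2 volume ∧
    eLpNorm (P φ₀ k (fun x => -(1/Real.pi : ℂ) * deriv F x)) 2 volume ≤
      ENNReal.ofReal (8 * 2 ^ k * (2:ℝ) ^ ((k:ℝ)/2)) * eLpNorm F 1 volume := by
  set T : ℝ → ℂ := fun x => -(1/Real.pi : ℂ) * deriv F x with hT
  have hpi : (π : ℂ) ≠ 0 := by exact_mod_cast Real.pi_ne_zero
  have hk : (0:ℝ) < 2 ^ k := by positivity
  by_cases hi : Integrable T
  swap
  · have : P φ₀ k T = 0 := by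
      ext x
      simp only [P, fourier_undef hi, mul_zero, inv_formula]
      simp
    rw [this]; simp
  have hi' : Integrable (deriv F) := by
    refine (hi.const_mul (-(π:ℂ))).congr (Eventually.of_forall fun x => ?_)
    simp only [hT]; field_simp
  have eT : ∀ ξ : ℝ, 𝓕 T ξ = -(2 * I * ξ) * 𝓕 F ξ := by
    intro ξ
    have h := congrFun (Real.fourier_deriv iF dF hi') ξ
    have h2 : 𝓕 T ξ = -(1/Real.pi : ℂ) * 𝓕 (deriv F) ξ := by
      rw [fourier_formula, fourier_formula, ← integral_const_mul]
      congr 1; ext x; simp only [hT]; ring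
    rw [h2, h, smul_eq_mul]; field_simp
  set G : ℝ → ℂ := fun ξ => (phi φ₀ k ξ : ℂ) * 𝓕 T ξ with hG
  have eP : P φ₀ k T = 𝓕⁻ G := rfl
  have pb : ∀ ξ : ℝ, ‖(phi φ₀ k ξ : ℂ) * -(2 * I * ξ)‖ ≤ 4 * 2 ^ k := by
    intro ξ
    by_cases h : phi φ₀ k ξ = 0
    · simp only [h]; simp; positivity
    · have h1 := (two_zpow_supp (phi_supp hφ k ξ h)).2
      have h2 : |phi φ₀ k ξ| ≤ 1 := by
        have := hφ.2.1 ((2:ℝ) ^ (-k) * ξ)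
        rw [phi, abs_of_nonneg this.1]; exact this.2
      simp
      calc |phi φ₀ k ξ| * (2 * |ξ|) ≤ 1 * (2 * (2 * (2:ℝ) ^ k)) := by gcongr
        _ = _ := by ring
  have bG : ∀ ξ, ‖G ξ‖ ≤ (4 * 2 ^ k) * ‖𝓕 F ξ‖ := by
    intro ξ
    simp only [hG]
    rw [eT, ← mul_assoc, norm_mul]
    gcongr
    exact pb ξ
  have cG : Continuous G :=
    (Complex.continuous_ofReal.comp (phi_cont hφ k)).mul (fourier_cont' T)
  have zG : ∀ ξ, ξ ∉ Icc (-(2 * (2:ℝ) ^ k)) (2 * (2:ℝ) ^ k) → G ξ = 0 := by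
    intro ξ h
    by_contra h'
    apply h
    have : phi φ₀ k ξ ≠ 0 := by
      intro h0; apply h'; simp [hG, h0]
    exact abs_le.1 (two_zpow_supp (phi_supp hφ k ξ this)).2
  have sG : HasCompactSupport G := HasCompactSupport.intro isCompact_Icc zG
  rw [eP, plancherelInv _ (cG.integrable_of_hasCompactSupport sG) (cG.memLp_of_hasCompactSupport sG)]
  constructor
  · rw [← plancherel F iF mF]
    exact eLpNorm_le_mul_eLpNorm_of_ae_le_mul (Eventually.of_forall bG) 2
  · set N := ∫ x, ‖F x‖ with hN
    have hN0 : 0 ≤ N := integral_nonneg fun x => norm_nonneg _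
    have e1 : eLpNorm F 1 volume = ENNReal.ofReal N := by
      rw [eLpNorm_one_eq_lintegral_enorm, ← ofReal_integral_norm_eq_lintegral_enorm iF]
    have b2 : ∀ ξ, ‖G ξ‖ ≤ ‖(Icc (-(2 * (2:ℝ) ^ k)) (2 * (2:ℝ) ^ k)).indicator
        (fun _ => 4 * 2 ^ k * N) ξ‖ := by
      intro ξ
      by_cases h : ξ ∈ Icc (-(2 * (2:ℝ) ^ k)) (2 * (2:ℝ) ^ k)
      · rw [indicator_of_mem h, Real.norm_of_nonneg (by positivity)]
        refine (bG ξ).trans ?_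
        gcongr
        exact fourier_norm_le F ξ
      · rw [zG ξ h]; simp
    refine (eLpNorm_mono b2).trans ?_
    rw [eLpNorm_indicator_const measurableSet_Icc (by norm_num) (by norm_num), Real.volume_Icc, e1]
    rw [Real.enorm_of_nonneg (by positivity)]
    have : (2 * (2:ℝ) ^ k - -(2 * 2 ^ k)) = 4 * 2 ^ k := by ring
    rw [this, ENNReal.ofReal_rpow_of_pos (by positivity), ← ENNReal.ofReal_mul (by positivity),
      ← ENNReal.ofReal_mul (by positivity)]
    apply ENNReal.ofReal_le_ofReal
    have e2 : (4 * (2:ℝ) ^ k) ^ (1 / (2:ℝ≥0∞).toReal) = 2 * (2:ℝ) ^ ((k:ℝ)/2) := by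
      rw [Real.mul_rpow (by norm_num) hk.le, ← Real.rpow_intCast, ← Real.rpow_mul (by norm_num)]
      congr 1
      · rw [show (4:ℝ) = 2 ^ (2:ℝ) by norm_num, ← Real.rpow_mul (by norm_num)]; norm_num
      · congr 1; simp; ring
    rw [e2]
    apply le_of_eq; ring

lemma TI_bound {A M : ℝ} (hA : 0 ≤ A) {k1 k2 k3 : ℤ}
    {g1 v1 u1 u1' u1'' g2 v2 u2 u2' u2'' g3 v3 u3 u3' u3'' : ℝ → ℂ}
    (h1 : Good A k1 g1 v1 u1 u1' u1'' M) (h2 : Good A k2 g2 v2 u2 u2' u2'' M)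
    (h3 : Good A k3 g3 v3 u3 u3' u3'' M) {p q : ℝ≥0∞} (hp : p = 1 ∨ p = 2) (hq : q = 2 ∨ q = ⊤)
    [ENNReal.HolderTriple 2 q p] :
    eLpNorm (TI u1 v2 v3) p volume ≤ ENNReal.ofReal (6 + (8 * A + 8 * A * π)) *
        (eLpNorm u1 2 volume * eLpNorm u2 q volume * eLpNorm u3 ⊤ volume) := by
  have hq' : q = 1 ∨ q = 2 ∨ q = ⊤ := Or.inr hq
  have hK : (0:ℝ) < 2 ^ (max k2 k3) := by positivity
  rw [ENNReal.ofReal_add (by norm_num) (by positivity)]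
  have hW := hilbert_bound h1.ig h1.mg h1.ig1 (R := ((2:ℝ) ^ (max k2 k3))⁻¹) (by positivity)
  rw [← h1.eq] at hW
  refine core hp hq (R := ((2:ℝ) ^ (max k2 k3))⁻¹) (by positivity) hA h1.du h1.bu' h2.dv h2.du
    (cont_of_deriv h2.du') h2.bv h2.bu h3.dv h3.du (cont_of_deriv h3.du') h3.bv h3.bu hW ?_ ?_ ?_
  · refine (h2.n1 q hq').trans ?_
    rw [div_inv_eq_mul]
    gcongr
    · norm_num
    · exact le_max_left _ _
  · refine (h3.n1 ⊤ (by simp)).trans ?_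
    rw [div_inv_eq_mul]
    gcongr
    · norm_num
    · exact le_max_right _ _
  · rcases le_total k2 k3 with h | h
    · right; rw [max_eq_right h]; exact h3.n0 ⊤ (by simp)
    · left; rw [max_eq_left h]; exact h2.n0 q hq'

lemma Good.memTwo {A M : ℝ} {k : ℤ} {g v u u' u'' : ℝ → ℂ} (h : Good A k g v u u' u'' M) :
    eLpNorm u 2 volume < ⊤ := by
  rw [h.eq, plancherelInv _ h.ig h.mg]
  exact h.mg.2

lemma Good.memTop {A M : ℝ} {k : ℤ} {g v u u' u'' : ℝ → ℂ} (h : Good A k g v u u' u'' M) :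
    eLpNorm u ⊤ volume < ⊤ :=
  (memLp_top_of_bound (cont_of_deriv h.du).aestronglyMeasurable M (Eventually.of_forall h.bu)).2

/-- **Lemma 4.1** (Localized `L²` estimates for the trilinear pseudoproduct).
`‖P_k 𝒯₃(P_{k₁}f₁,P_{k₂}f₂,P_{k₃}f₃)‖_{L²} ≲ 2^k ‖P_{k₁}f₁‖_{L²}‖P_{k₂}f₂‖_{L^∞}‖P_{k₃}f₃‖_{L^∞}`
and `≲ 2^{3k/2} ‖P_{k₁}f₁‖_{L²}‖P_{k₂}f₂‖_{L²}‖P_{k₃}f₃‖_{L^∞}`. -/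
theorem trilinear_localized_L2 (φ₀ : ℝ → ℝ) (hφ : IsLPBump φ₀) :
    ∃ C : ℝ, 0 < C ∧
      ∀ (f₁ f₂ f₃ : ℝ → ℂ) (k k₁ k₂ k₃ : ℤ),
        (eLpNorm (P φ₀ k (T3 (P φ₀ k₁ f₁) (P φ₀ k₂ f₂) (P φ₀ k₃ f₃))) 2 volume ≤
          ENNReal.ofReal (C * (2:ℝ)^k) *
            (eLpNorm (P φ₀ k₁ f₁) 2 volume * eLpNorm (P φ₀ k₂ f₂) ⊤ volume *
              eLpNorm (P φ₀ k₃ f₃) ⊤ volume)) ∧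
        (eLpNorm (P φ₀ k (T3 (P φ₀ k₁ f₁) (P φ₀ k₂ f₂) (P φ₀ k₃ f₃))) 2 volume ≤
          ENNReal.ofReal (C * (2:ℝ)^k * (2:ℝ) ^ ((k:ℝ)/2)) *
            (eLpNorm (P φ₀ k₁ f₁) 2 volume * eLpNorm (P φ₀ k₂ f₂) 2 volume *
              eLpNorm (P φ₀ k₃ f₃) ⊤ volume)) := by
  obtain ⟨A, hA, H⟩ := good_exists hφ
  have hπ := Real.pi_pos
  refine ⟨8 * (6 + (8 * A + 8 * A * π)), by positivity, ?_⟩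
  intro f₁ f₂ f₃ k k₁ k₂ k₃
  obtain ⟨g1, v1, u1', u1'', M1, h1⟩ := H k₁ f₁
  obtain ⟨g2, v2, u2', u2'', M2, h2⟩ := H k₂ f₂
  obtain ⟨g3, v3, u3', u3'', M3, h3⟩ := H k₃ f₃
  replace h1 := h1.mono ((le_max_left M1 M2).trans (le_max_left _ M3))
  replace h2 := h2.mono ((le_max_right M1 M2).trans (le_max_left _ M3))
  replace h3 := h3.mono (le_max_right (max M1 M2) M3)
  have dF := TI_diff h1 h2 h3
  have hb2 := TI_bound hA h1 h2 h3 (p := 2) (q := ⊤) (Or.inr rfl) (Or.inr rfl)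
  have hb1 := TI_bound hA h1 h2 h3 (p := 1) (q := 2) (Or.inl rfl) (Or.inl rfl)
  have mF : AEStronglyMeasurable (TI (P φ₀ k₁ f₁) v2 v3) volume := dF.continuous.aestronglyMeasurable
  have m1 : MemLp (TI (P φ₀ k₁ f₁) v2 v3) 1 volume := ⟨mF, hb1.trans_lt
    (ENNReal.mul_lt_top ENNReal.ofReal_lt_top
      (ENNReal.mul_lt_top (ENNReal.mul_lt_top h1.memTwo h2.memTwo) h3.memTop))⟩
  have m2 : MemLp (TI (P φ₀ k₁ f₁) v2 v3) 2 volume := ⟨mF, hb2.trans_lt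
    (ENNReal.mul_lt_top ENNReal.ofReal_lt_top
      (ENNReal.mul_lt_top (ENNReal.mul_lt_top h1.memTwo h2.memTop) h3.memTop))⟩
  obtain ⟨L1, L2⟩ := last_step hφ k dF (memLp_one_iff_integrable.1 m1) m2
  rw [T3_eq h1 h2 h3]
  constructor
  · refine (L1.trans (mul_le_mul_right hb2 _)).trans ?_
    rw [← mul_assoc, ← ENNReal.ofReal_mul (by positivity)]
    gcongr ENNReal.ofReal ?_ * _
    have : (0:ℝ) ≤ 2 ^ k * (6 + (8 * A + 8 * A * π)) := by positivity
    linarith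
  · refine (L2.trans (mul_le_mul_right hb1 _)).trans ?_
    rw [← mul_assoc, ← ENNReal.ofReal_mul (by positivity)]
    gcongr ENNReal.ofReal ?_ * _
    apply le_of_eq; ring

end Muskat
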